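/- arXiv:2112.07280 — 4 statements merged into one kernel-verified Lean document; each statement's English description precedes it below -/
import Mathlib

section
/- In the constrained composition setup, one has sup over t ∈ [−1,1]^d of |C_w(t) − C_z(t)| ≤ K_H · δ(w, z), where K_H = (1 + K_max · d_max)^H. -/
open Set

/-- The cube `[-1,1]^n` in `ℝ^n`. -/
def cube (n : ℕ) : Set (Fin n → ℝ) := Set.univ.pi fun _ => Set.Icc (-1 : ℝ) 1

/-- Iterated composition of the layer maps: `iterComp d w k = w_k ∘ ⋯ ∘ w_1` in the paper's
1-indexed notation (0-indexed layers `h = 0, …, H-1` here). -/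
def iterComp (d : ℕ → ℕ) (w : ∀ h : ℕ, (Fin (d h) → ℝ) → (Fin (d (h + 1)) → ℝ)) :
    ∀ k : ℕ, (Fin (d 0) → ℝ) → (Fin (d k) → ℝ)
  | 0 => fun t => t
  | k + 1 => fun t => w k (iterComp d w k t)

theorem abs_apply_le_of_abs_apply_single_le {n : ℕ} {K : ℝ} (L : (Fin n → ℝ) →L[ℝ] ℝ)
    (hL : ∀ j, |L (Pi.single j 1)| ≤ K) (v : Fin n → ℝ) : |L v| ≤ K * n * ‖v‖ := by
  have hv : L v = ∑ j, v j * L (Pi.single j 1) := by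
    conv_lhs => rw [pi_eq_sum_univ' v]
    simp only [map_sum, map_smul, smul_eq_mul]
  calc |L v| = |∑ j, v j * L (Pi.single j 1)| := by rw [hv]
    _ ≤ ∑ j, |v j * L (Pi.single j 1)| := Finset.abs_sum_le_sum_abs _ _
    _ ≤ ∑ _j : Fin n, ‖v‖ * K := by
        refine Finset.sum_le_sum fun j _ => ?_
        rw [abs_mul]
        exact mul_le_mul (norm_le_pi_norm v j) (hL j) (abs_nonneg _) (norm_nonneg _)
    _ = K * n * ‖v‖ := by
        rw [Finset.sum_const, Finset.card_univ, Fintype.card_fin, nsmul_eq_mul]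
        ring

theorem convex_cube (n : ℕ) : Convex ℝ (cube n) :=
  convex_pi fun _ _ => convex_Icc _ _

theorem mem_cube_iff {n : ℕ} {t : Fin n → ℝ} : t ∈ cube n ↔ ∀ i, |t i| ≤ 1 := by
  simp only [cube, Set.mem_univ_pi, Set.mem_Icc, abs_le]

/-- A differentiable function on the cube with partial derivatives bounded by `K` is
`K * n`-Lipschitz for the sup norm. -/
theorem abs_sub_le_of_partial_le {n : ℕ} {K : ℝ} (hK : 0 ≤ K) {f : (Fin n → ℝ) → ℝ}
    (hf : DifferentiableOn ℝ f (cube n))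
    (hf' : ∀ j, ∀ t ∈ cube n, |fderivWithin ℝ f (cube n) t (Pi.single j 1)| ≤ K)
    {x y : Fin n → ℝ} (hx : x ∈ cube n) (hy : y ∈ cube n) :
    |f x - f y| ≤ K * n * ‖x - y‖ :=
  (convex_cube n).norm_image_sub_le_of_norm_fderivWithin_le hf
    (fun t ht => ContinuousLinearMap.opNorm_le_bound _ (by positivity)
      (abs_apply_le_of_abs_apply_single_le _ fun j => hf' j t ht)) hy hx

theorem iterComp_mem_cube {H : ℕ} {d : ℕ → ℕ}
    {w : ∀ h : ℕ, (Fin (d h) → ℝ) → (Fin (d (h + 1)) → ℝ)}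
    (hw : ∀ h, h + 1 < H → ∀ i, ∀ t ∈ cube (d h), |w h t i| ≤ 1)
    {t : Fin (d 0) → ℝ} (ht : t ∈ cube (d 0)) :
    ∀ k, k < H → iterComp d w k t ∈ cube (d k)
  | 0, _ => ht
  | k + 1, hk => mem_cube_iff.2 fun i =>
      hw k hk i _ (iterComp_mem_cube hw ht k (Nat.lt_of_succ_lt hk))

/-- in the constrained composition setup,
`sup_{t ∈ [-1,1]^d} |C_w(t) - C_z(t)| ≤ (1 + K_max · d_max)^H · δ(w,z)`. -/
theorem stmt4
    (H : ℕ) (hH : 2 ≤ H)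
    (d : ℕ → ℕ) (hd : ∀ h, h ≤ H → 0 < d h) (hdH : d H = 1)
    (dmax : ℕ) (hdmax : ∀ h, h < H → d h ≤ dmax)
    (Kmax : ℝ) (hKmax : 0 < Kmax)
    (w z : ∀ h : ℕ, (Fin (d h) → ℝ) → (Fin (d (h + 1)) → ℝ))
    (hwcont : ∀ h, h < H → ∀ i, ContinuousOn (fun t => w h t i) (cube (d h)))
    (hzcont : ∀ h, h < H → ∀ i, ContinuousOn (fun t => z h t i) (cube (d h)))
    (hwval : ∀ h, h + 1 < H → ∀ i, ∀ t ∈ cube (d h), |w h t i| ≤ 1)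
    (hzval : ∀ h, h + 1 < H → ∀ i, ∀ t ∈ cube (d h), |z h t i| ≤ 1)
    (hwsmooth : ∀ h, 1 ≤ h → h < H → ∀ i, ContDiffOn ℝ 1 (fun t => w h t i) (cube (d h)))
    (hzsmooth : ∀ h, 1 ≤ h → h < H → ∀ i, ContDiffOn ℝ 1 (fun t => z h t i) (cube (d h)))
    (hwderiv : ∀ h, 1 ≤ h → h < H → ∀ i j, ∀ t ∈ cube (d h),
      |fderivWithin ℝ (fun s => w h s i) (cube (d h)) t (Pi.single j 1)| ≤ Kmax)
    (hzderiv : ∀ h, 1 ≤ h → h < H → ∀ i j, ∀ t ∈ cube (d h),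
      |fderivWithin ℝ (fun s => z h s i) (cube (d h)) t (Pi.single j 1)| ≤ Kmax)
    (δ : ℝ) (hδ : ∀ h, h < H → ∀ i, ∀ t ∈ cube (d h), |w h t i - z h t i| ≤ δ) :
    ∀ t ∈ cube (d 0), ∀ i : Fin (d H),
      |iterComp d w H t i - iterComp d z H t i| ≤ (1 + Kmax * dmax) ^ H * δ := by
  intro t ht
  have hδ0 : 0 ≤ δ :=
    (abs_nonneg _).trans (hδ 0 (by omega) ⟨0, hd 1 (by omega)⟩ t ht)
  have hA : 0 ≤ Kmax * dmax := by positivity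
  suffices h : ∀ k, k ≤ H →
      ‖iterComp d w k t - iterComp d z k t‖ ≤ (1 + Kmax * dmax) ^ k * δ from
    fun i => (norm_le_pi_norm (iterComp d w H t - iterComp d z H t) i).trans (h H le_rfl)
  intro k
  induction k with
  | zero => simpa [iterComp] using hδ0
  | succ k ih =>
    intro hk
    have hkH : k < H := hk
    have hx := iterComp_mem_cube hwval ht k hkH
    have hy := iterComp_mem_cube hzval ht k hkH
    have hpow : 1 ≤ (1 + Kmax * dmax) ^ k := one_le_pow₀ (by linarith)
    refine (pi_norm_le_iff_of_nonneg (by positivity)).2 fun i => ?_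
    have hlayer : |z k (iterComp d w k t) i - z k (iterComp d z k t) i| ≤
        Kmax * dmax * ((1 + Kmax * dmax) ^ k * δ) := by
      rcases Nat.eq_zero_or_pos k with rfl | hk0
      · simp only [iterComp, sub_self, abs_zero]
        positivity
      · refine (abs_sub_le_of_partial_le (f := fun s => z k s i) hKmax.le
          ((hzsmooth k hk0 hkH i).differentiableOn one_ne_zero)
          (hzderiv k hk0 hkH i) hx hy).trans ?_
        have hdk : (d k : ℝ) ≤ dmax := by exact_mod_cast hdmax k hkH
        have := ih hkH.le
        gcongr
    calc |w k (iterComp d w k t) i - z k (iterComp d z k t) i|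
        ≤ |w k (iterComp d w k t) i - z k (iterComp d w k t) i| +
          |z k (iterComp d w k t) i - z k (iterComp d z k t) i| := abs_sub_le _ _ _
      _ ≤ 1 * δ + Kmax * dmax * ((1 + Kmax * dmax) ^ k * δ) := by
          rw [one_mul]
          exact add_le_add (hδ k hkH i _ hx) hlayer
      _ ≤ (1 + Kmax * dmax) ^ k * δ + Kmax * dmax * ((1 + Kmax * dmax) ^ k * δ) := by
          gcongr
      _ = (1 + Kmax * dmax) ^ (k + 1) * δ := by ring
end

section
/- Let T be a compact metric space and let X = (X_t)_{t ∈ T} be a centered Gaussian process on a probability space (Ω, ℱ, ℙ) all of whose sample paths t ↦ X_t(ω) are continuous. Then for every u > 0, ℙ( sup_{t ∈ T} |X_t| ≤ u ) > 0. -/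
open MeasureTheory ProbabilityTheory

/-- The difference of two independent copies of a centered Gaussian variable is centered Gaussian
with twice the variance. -/
lemma hasLaw_sub_prod_gaussianReal {Ω : Type*} [MeasurableSpace Ω] {P : Measure Ω}
    [IsProbabilityMeasure P] {Z : Ω → ℝ} {v : NNReal} (hZ : HasLaw Z (gaussianReal 0 v) P) :
    HasLaw (fun p : Ω × Ω => Z p.1 - Z p.2) (gaussianReal 0 (v + v)) (P.prod P) := by
  have h1 : HasLaw (fun p : Ω × Ω => Z p.1) (gaussianReal 0 v) (P.prod P) :=
    hZ.fun_comp measurePreserving_fst.hasLaw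
  have h2 : HasLaw (fun p : Ω × Ω => Z p.2) (gaussianReal 0 v) (P.prod P) :=
    hZ.fun_comp measurePreserving_snd.hasLaw
  have h := gaussianReal_add_gaussianReal_of_indepFun
    (indepFun_prod₀ hZ.aemeasurable hZ.aemeasurable.neg) h1.map_eq (gaussianReal_neg h2).map_eq
  refine ⟨h1.aemeasurable.sub h2.aemeasurable, ?_⟩
  simpa [sub_eq_add_neg, Pi.add_def] using h

/-- For a centered Gaussian process, the difference of two independent copies has the law of
`√2` times the process. -/
lemma map_sub_prod_eq_map_sqrt_two_mul {ι Ω : Type*} [MeasurableSpace Ω] (P : Measure Ω)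
    [IsProbabilityMeasure P] (Y : ι → Ω → ℝ) (hY : ∀ i, Measurable (Y i))
    (hgauss : ∀ (I : Finset ι) (c : I → ℝ), ∃ v : NNReal,
      HasLaw (fun ω => ∑ i, c i * Y i ω) (gaussianReal 0 v) P) :
    (P.prod P).map (fun p i => Y i p.1 - Y i p.2) =
      (P.prod P).map (fun p i => √2 * Y i p.1) := by
  classical
  refine (map_eq_iff_forall_finset_map_restrict_eq (X := fun i (p : Ω × Ω) => Y i p.1 - Y i p.2)
    (Y := fun i (p : Ω × Ω) => √2 * Y i p.1) (measurable_pi_lambda _ fun i => by fun_prop).aemeasurable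
    (measurable_pi_lambda _ fun i => by fun_prop).aemeasurable).2 fun I => ?_
  refine Measure.ext_of_charFunDual <| funext fun L => ?_
  rw [charFunDual_eq_charFun_map_one, charFunDual_eq_charFun_map_one]
  congr 1
  rw [Measure.map_map (by fun_prop) (by fun_prop), Measure.map_map (by fun_prop) (by fun_prop)]
  obtain ⟨v, hv⟩ := hgauss I fun i => L (Pi.single i 1)
  set Z : Ω → ℝ := fun ω => ∑ i : I, L (Pi.single i 1) * Y i ω with hZ
  have hL (x : I → ℝ) : L x = ∑ i, L (Pi.single i 1) * x i := by
    conv_lhs => rw [pi_eq_sum_univ' x, map_sum]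
    refine Finset.sum_congr rfl fun i _ => ?_
    rw [map_smul, smul_eq_mul, mul_comm]
  have e1 : (L ∘ fun p : Ω × Ω => I.restrict fun i => Y i p.1 - Y i p.2) =
      fun p => Z p.1 - Z p.2 := by
    ext p
    refine (hL _).trans ?_
    simp only [hZ, Finset.restrict, mul_sub, Finset.sum_sub_distrib]
  have e2 : (L ∘ fun p : Ω × Ω => I.restrict fun i => √2 * Y i p.1) =
      fun p => √2 * Z p.1 := by
    ext p
    refine (hL _).trans ?_
    simp only [hZ, Finset.restrict, Finset.mul_sum, mul_left_comm]
  have h1 : HasLaw (fun p : Ω × Ω => Z p.1) (gaussianReal 0 v) (P.prod P) :=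
    hv.fun_comp measurePreserving_fst.hasLaw
  rw [e1, e2, (hasLaw_sub_prod_gaussianReal hv).map_eq, (gaussianReal_const_mul h1 √2).map_eq]
  congr 1
  · simp
  · ext
    simp
    ring

/-- a centered Gaussian process with continuous sample paths on a compact metric
space has, for every `u > 0`, positive probability that the sup of its absolute value is at
most `u`. The centered Gaussian hypothesis is expressed through the standard characterization:
every finite linear combination of values of the process has a (possibly degenerate) centered
real Gaussian distribution. -/
theorem stmt8 {T : Type*} [MetricSpace T] [CompactSpace T] [Nonempty T]
    {Ω : Type*} [MeasurableSpace Ω] (P : Measure Ω) [IsProbabilityMeasure P]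
    (X : T → Ω → ℝ)
    (hmeas : ∀ t, Measurable (X t))
    (hcont : ∀ ω, Continuous fun t => X t ω)
    (hgauss : ∀ (n : ℕ) (t : Fin n → T) (c : Fin n → ℝ), ∃ v : NNReal,
      Measure.map (fun ω => ∑ i, c i * X (t i) ω) P = gaussianReal 0 v)
    (u : ℝ) (hu : 0 < u) :
    0 < P {ω | (⨆ t, |X t ω|) ≤ u} := by
  let d : ℕ → T := TopologicalSpace.denseSeq T
  have hd : DenseRange d := TopologicalSpace.denseRange_denseSeq T
  let Y : ℕ → Ω → ℝ := fun n => X (d n)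
  have hYm (n : ℕ) : Measurable (Y n) := hmeas _
  have hYg (I : Finset ℕ) (c : I → ℝ) : ∃ v : NNReal,
      HasLaw (fun ω => ∑ i, c i * Y i ω) (gaussianReal 0 v) P := by
    let e := (Fintype.equivFin I).symm
    obtain ⟨v, hv⟩ := hgauss _ (fun k => d (e k)) (fun k => c (e k))
    refine ⟨v, by fun_prop, ?_⟩
    rw [← hv]
    congr 1
    ext ω
    exact (e.sum_comp fun i => c i * Y i ω).symm
  have hlaw := map_sub_prod_eq_map_sqrt_two_mul P Y hYm hYg
  let f : ℕ → C(T, ℝ) := TopologicalSpace.denseSeq C(T, ℝ)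
  have hf : DenseRange f := TopologicalSpace.denseRange_denseSeq C(T, ℝ)
  let A : ℕ → Set Ω := fun k => {ω | ∀ n, |Y n ω - f k (d n)| ≤ u / 2}
  obtain ⟨k, hk⟩ : ∃ k, 0 < P (A k) := by
    refine exists_measure_pos_of_not_measure_iUnion_null ?_
    have : ⋃ k, A k = Set.univ := by
      refine Set.eq_univ_of_forall fun ω => Set.mem_iUnion.2 ?_
      obtain ⟨k, hk⟩ := hf.exists_dist_lt ⟨fun t => X t ω, hcont ω⟩ (half_pos hu)
      exact ⟨k, fun n => ((ContinuousMap.dist_apply_le_dist (d n)).trans hk.le)⟩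
    simp [this]
  let S : Set (ℕ → ℝ) := {x | ∀ n, |x n| ≤ u}
  have hS : MeasurableSet S := by
    simp only [S, Set.ofPred_forall]
    exact MeasurableSet.iInter fun n => measurableSet_le (by fun_prop) (by fun_prop)
  have hpos : 0 < (P.prod P).map (fun p i => Y i p.1 - Y i p.2) S := by
    rw [Measure.map_apply (by fun_prop) hS]
    refine (ENNReal.mul_pos hk.ne' hk.ne').trans_le ?_
    rw [← Measure.prod_prod]
    refine measure_mono fun p hp n => ?_
    have h1 := abs_le.1 (hp.1 n)
    have h2 := abs_le.1 (hp.2 n)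
    exact abs_le.2 ⟨by linarith, by linarith⟩
  rw [hlaw, Measure.map_apply (by fun_prop) hS] at hpos
  refine hpos.trans_le ?_
  have hsub : (fun (p : Ω × Ω) i => √2 * Y i p.1) ⁻¹' S ⊆
      {ω | (⨆ t, |X t ω|) ≤ u} ×ˢ Set.univ := by
    refine fun p hp => Set.mk_mem_prod (Set.mem_ofPred_eq ▸ ciSup_le fun t => ?_) trivial
    have hcl : IsClosed {t | |X t p.1| ≤ u} :=
      isClosed_le (hcont p.1).abs continuous_const
    refine hd.induction_on t hcl fun n => ?_
    have h1 : |√2 * Y n p.1| ≤ u := hp n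
    rw [abs_mul, abs_of_nonneg (Real.sqrt_nonneg 2)] at h1
    exact (le_mul_of_one_le_left (abs_nonneg _) (Real.one_le_sqrt.2 one_le_two)).trans h1
  refine (measure_mono hsub).trans ?_
  rw [Measure.prod_prod, measure_univ, mul_one]
end

section
/- Let T be a compact metric space and let X = (X_t)_{t ∈ T} be a centered Gaussian process on a probability space (Ω, ℱ, ℙ) all of whose sample paths t ↦ X_t(ω) are continuous. Then for every u > 0, ℙ( sup_{t ∈ T} |X_t| = u ) = 0; in other words, the random variable sup_{t ∈ T} |X_t| has no atoms on the half-line (0, +∞). -/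
open MeasureTheory ProbabilityTheory Filter Topology

/-- A vector space of real random variables all of which are centered Gaussian. -/
structure IsCenteredGaussianSpace {Ω : Type*} [MeasurableSpace Ω] (V : Submodule ℝ (Ω → ℝ))
    (P : Measure Ω) : Prop where
  measurable : ∀ ξ ∈ V, Measurable ξ
  map_eq : ∀ ξ ∈ V, ∃ v : NNReal, P.map ξ = gaussianReal 0 v

namespace IsCenteredGaussianSpace

variable {Ω : Type*} [MeasurableSpace Ω] {P : Measure Ω} {V : Submodule ℝ (Ω → ℝ)}
  {ξ η : Ω → ℝ}

lemma hasGaussianLaw (hV : IsCenteredGaussianSpace V P) (hξ : ξ ∈ V) : HasGaussianLaw ξ P where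
  isGaussian_map := by
    obtain ⟨v, hv⟩ := hV.map_eq ξ hξ
    rw [hv]
    infer_instance

lemma memLp_two (hV : IsCenteredGaussianSpace V P) (hξ : ξ ∈ V) : MemLp ξ 2 P :=
  (hV.hasGaussianLaw hξ).memLp_two

lemma integral_eq_zero (hV : IsCenteredGaussianSpace V P) (hξ : ξ ∈ V) : P[ξ] = 0 := by
  obtain ⟨v, hv⟩ := hV.map_eq ξ hξ
  have h := integral_map (μ := P) (hV.measurable ξ hξ).aemeasurable (f := fun x : ℝ => x)
    (by fun_prop)
  rw [← h, hv, integral_id_gaussianReal]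

lemma map_eq_gaussianReal (hV : IsCenteredGaussianSpace V P) (hξ : ξ ∈ V) :
    P.map ξ = gaussianReal 0 Var[ξ; P].toNNReal := by
  rw [(hV.hasGaussianLaw hξ).map_eq_gaussianReal, hV.integral_eq_zero hξ]

lemma integral_cos [IsProbabilityMeasure P] (hV : IsCenteredGaussianSpace V P) (hξ : ξ ∈ V) :
    ∫ ω, Real.cos (ξ ω) ∂P = Real.exp (-Var[ξ; P] / 2) := by
  have h := charFun_gaussianReal (μ := 0) (v := Var[ξ; P].toNNReal) 1
  rw [← hV.map_eq_gaussianReal hξ, charFun_apply_real,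
    integral_map (hV.measurable ξ hξ).aemeasurable (by fun_prop)] at h
  have hint : Integrable (fun ω => Complex.exp ((1 : ℝ) * ξ ω * Complex.I)) P := by
    refine Integrable.of_bound (C := 1) ?_ (ae_of_all _ fun ω => ?_)
    · have := hV.measurable ξ hξ
      fun_prop
    · rw [← Complex.ofReal_mul, Complex.norm_exp_ofReal_mul_I]
  have h2 := integral_re hint
  simp only [RCLike.re_eq_complex_re] at h2
  rw [h] at h2
  simpa [Complex.exp_re, max_eq_left (variance_nonneg ξ P), neg_div, ← Complex.ofReal_pow]
    using h2

lemma isGaussianProcess [IsProbabilityMeasure P] (hV : IsCenteredGaussianSpace V P) {S : Type*}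
    {Y : S → Ω → ℝ} (hY : ∀ s, Y s ∈ V) : IsGaussianProcess Y P where
  hasGaussianLaw I := by
    classical
    have hm : Measurable (fun ω => I.restrict (Y · ω)) :=
      measurable_pi_lambda _ fun i => hV.measurable _ (hY i)
    refine ⟨isGaussian_of_map_eq_gaussianReal fun L => ?_⟩
    have hL : L ∘ (fun ω => I.restrict (Y · ω)) =
        ∑ i : I, L (fun j => if i = j then 1 else 0) • Y i := by
      ext ω
      rw [Function.comp_apply, ← ContinuousLinearMap.coe_coe, LinearMap.pi_apply_eq_sum_univ]
      simp [mul_comm]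
    rw [Measure.map_map (by fun_prop) hm, hL]
    obtain ⟨v, hv⟩ := hV.map_eq _ (V.sum_mem fun i _ => V.smul_mem (L (fun j => if i = j then 1 else 0)) (hY i))
    exact ⟨0, v, hv⟩

lemma ae_eq_zero_of_tendsto [IsProbabilityMeasure P] (hV : IsCenteredGaussianSpace V P)
    {ζ : ℕ → Ω → ℝ} (hζ : ∀ n, ζ n ∈ V) {Y : Ω → ℝ}
    (hlim : ∀ ω, Tendsto (fun n => ζ n ω) atTop (𝓝 (Y ω)))
    (hcov : ∀ m, Tendsto (fun n => cov[ζ m, ζ n; P]) atTop (𝓝 0)) :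
    Y =ᵐ[P] 0 := by
  have hm : ∀ n, Measurable (ζ n) := fun n => hV.measurable _ (hζ n)
  have hYm : Measurable Y := measurable_of_tendsto_metrizable hm (tendsto_pi_nhds.2 hlim)
  have hcos : ∀ {Z : ℕ → Ω → ℝ} {W : Ω → ℝ}, (∀ n, Measurable (Z n)) →
      (∀ ω, Tendsto (fun n => Z n ω) atTop (𝓝 (W ω))) →
      Tendsto (fun n => ∫ ω, Real.cos (Z n ω) ∂P) atTop (𝓝 (∫ ω, Real.cos (W ω) ∂P)) := by
    intro Z W hZ hW
    refine tendsto_integral_of_dominated_convergence (fun _ => 1) (fun n => ?_)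
      (integrable_const _) (fun n => ae_of_all _ fun ω => ?_) (ae_of_all _ fun ω => ?_)
    · exact (Real.measurable_cos.comp (hZ n)).aestronglyMeasurable
    · simpa using Real.abs_cos_le_one _
    · exact (Real.continuous_cos.tendsto _).comp (hW ω)
  set a := ∫ ω, Real.cos (Y ω) ∂P with ha
  have h1 : Tendsto (fun n => Real.exp (-Var[ζ n; P] / 2)) atTop (𝓝 a) := by
    simpa only [hV.integral_cos (hζ _)] using hcos hm hlim
  have h2 : ∀ m, ∫ ω, Real.cos (ζ m ω - Y ω) ∂P = Real.exp (-Var[ζ m; P] / 2) * a := by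
    intro m
    have h3 := hcos (Z := fun n ω => ζ m ω - ζ n ω) (W := fun ω => ζ m ω - Y ω)
      (fun n => (hm m).sub (hm n)) (fun ω => tendsto_const_nhds.sub (hlim ω))
    have h4 : ∀ n, ∫ ω, Real.cos (ζ m ω - ζ n ω) ∂P =
        Real.exp (-Var[ζ m; P] / 2) * Real.exp (-Var[ζ n; P] / 2) *
          Real.exp (cov[ζ m, ζ n; P]) := by
      intro n
      have := hV.integral_cos (V.sub_mem (hζ m) (hζ n))
      rw [variance_sub (hV.memLp_two (hζ m)) (hV.memLp_two (hζ n))] at this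
      simp only [Pi.sub_apply] at this
      rw [this, ← Real.exp_add, ← Real.exp_add]
      congr 1
      ring
    simp only [h4] at h3
    have h5 := (h1.const_mul (Real.exp (-Var[ζ m; P] / 2))).mul
      ((Real.continuous_exp.tendsto _).comp (hcov m))
    simp only [Real.exp_zero, mul_one] at h5
    exact tendsto_nhds_unique h3 h5
  have h3 : a * a = 1 := by
    have h4 := hcos (Z := fun n ω => ζ n ω - Y ω) (W := fun _ => 0)
      (fun n => (hm n).sub hYm) (fun ω => by simpa using (hlim ω).sub_const (Y ω))
    simp only [h2, Real.cos_zero, integral_const, probReal_univ, smul_eq_mul, mul_one] at h4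
    exact tendsto_nhds_unique (h1.mul_const a) h4
  have ha0 : 0 ≤ a := ge_of_tendsto' h1 fun n => (Real.exp_pos _).le
  have ha1 : a = 1 := by nlinarith
  have hvar : Tendsto (fun n => Var[ζ n; P]) atTop (𝓝 0) := by
    rw [ha1] at h1
    have := ((Real.continuousAt_log one_ne_zero).tendsto.comp h1).const_mul (-2)
    simp only [Function.comp_def, Real.log_exp, Real.log_one, mul_zero] at this
    exact this.congr fun n => by ring
  have hfatou := lintegral_liminf_le (μ := P) (u := atTop) (f := fun n ω => ENNReal.ofReal (ζ n ω ^ 2))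
    (fun n => ((hm n).pow_const 2).ennreal_ofReal)
  have hL : ∀ ω, liminf (fun n => ENNReal.ofReal (ζ n ω ^ 2)) atTop = ENNReal.ofReal (Y ω ^ 2) :=
    fun ω => (ENNReal.tendsto_ofReal ((hlim ω).pow 2)).liminf_eq
  have hR : ∀ n, ∫⁻ ω, ENNReal.ofReal (ζ n ω ^ 2) ∂P = ENNReal.ofReal (Var[ζ n; P]) := by
    intro n
    rw [variance_of_integral_eq_zero (hm n).aemeasurable (hV.integral_eq_zero (hζ n)),
      ofReal_integral_eq_lintegral_ofReal (hV.memLp_two (hζ n)).integrable_sq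
        (ae_of_all _ fun ω => sq_nonneg _)]
  simp only [hL, hR] at hfatou
  rw [(ENNReal.tendsto_ofReal hvar).liminf_eq, ENNReal.ofReal_zero, nonpos_iff_eq_zero,
    lintegral_eq_zero_iff (hYm.pow_const 2).ennreal_ofReal] at hfatou
  filter_upwards [hfatou] with ω hω
  simp only [Pi.zero_apply, ENNReal.ofReal_eq_zero] at hω
  exact pow_eq_zero_iff two_ne_zero |>.1 (le_antisymm hω (sq_nonneg _))

lemma continuous_variance [IsProbabilityMeasure P] (hV : IsCenteredGaussianSpace V P)
    {T : Type*} [TopologicalSpace T] [FirstCountableTopology T] {X : T → Ω → ℝ}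
    (hX : ∀ t, X t ∈ V) (hcont : ∀ ω, Continuous fun t => X t ω) :
    Continuous fun t => Var[X t; P] := by
  have h : Continuous fun t => ∫ ω, Real.cos (X t ω) ∂P := by
    refine continuous_of_dominated (bound := fun _ => 1) (fun t => ?_)
      (fun t => ae_of_all _ fun ω => ?_) (integrable_const _) (ae_of_all _ fun ω => ?_)
    · exact (Real.measurable_cos.comp (hV.measurable _ (hX t))).aestronglyMeasurable
    · simpa using Real.abs_cos_le_one _
    · exact Real.continuous_cos.comp (hcont ω)
  have h2 := (h.log fun t => by rw [hV.integral_cos (hX t)]; positivity).const_mul (-2)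
  refine h2.congr fun t => ?_
  rw [hV.integral_cos (hX t), Real.log_exp]
  ring

lemma continuous_covariance [IsProbabilityMeasure P] (hV : IsCenteredGaussianSpace V P)
    {T : Type*} [TopologicalSpace T] [FirstCountableTopology T] {X : T → Ω → ℝ}
    (hX : ∀ t, X t ∈ V) (hcont : ∀ ω, Continuous fun t => X t ω) (hξ : ξ ∈ V) :
    Continuous fun t => cov[ξ, X t; P] := by
  have h1 := hV.continuous_variance (X := fun t => ξ + X t) (fun t => V.add_mem hξ (hX t))
    (fun ω => continuous_const.add (hcont ω))
  have h2 := hV.continuous_variance hX hcont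
  refine (((h1.sub h2).sub (continuous_const (y := Var[ξ; P]))).div_const 2).congr fun t => ?_
  simp only [Pi.sub_apply, variance_add (hV.memLp_two hξ) (hV.memLp_two (hX t))]
  ring

lemma measure_iSup_eq_and_iSup_add_covariance_lt [IsProbabilityMeasure P]
    (hV : IsCenteredGaussianSpace V P) {Y : ℕ → Ω → ℝ} (hY : ∀ n, Y n ∈ V) (hξ : ξ ∈ V)
    (hYb : ∀ ω, BddAbove (Set.range fun n => |Y n ω|))
    (hcb : BddAbove (Set.range fun n => |cov[ξ, Y n; P]|)) (u : ℝ) :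
    P {ω | ⨆ n, |Y n ω| = u ∧ ⨆ n, |Y n ω + cov[ξ, Y n; P]| < u} = 0 := by
  obtain hv | hv := (variance_nonneg ξ P).eq_or_lt
  · have h0 : ξ =ᵐ[P] 0 := by
      have := ae_eq_integral_of_variance_eq_zero (hV.memLp_two hξ) hv.symm
      rw [hV.integral_eq_zero hξ] at this
      exact this
    have hc : ∀ n, cov[ξ, Y n; P] = 0 := fun n => by
      rw [covariance, hV.integral_eq_zero hξ]
      refine integral_eq_zero_of_ae ?_
      filter_upwards [h0] with ω hω
      simp [hω]
    simp only [hc, add_zero]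
    convert measure_empty (μ := P)
    ext ω
    simp only [Set.mem_ofPred_eq, Set.mem_empty_iff_false, iff_false]
    rintro ⟨h1, h2⟩
    exact h2.ne h1
  set v := Var[ξ; P] with hvdef
  set c : ℕ → ℝ := fun n => cov[ξ, Y n; P] / v with hc
  have hcv : ∀ n, cov[ξ, Y n; P] = v * c n := fun n => by simp only [hc]; field_simp
  have hcb' : BddAbove (Set.range fun n => |c n|) := by
    obtain ⟨C, hC⟩ := hcb
    refine ⟨C / v, ?_⟩
    rintro _ ⟨n, rfl⟩
    simp only [hc, abs_div, abs_of_pos hv]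
    exact div_le_div_of_nonneg_right (hC ⟨n, rfl⟩) hv.le
  have hbdd : ∀ {z : ℕ → ℝ}, BddAbove (Set.range fun n => |z n|) → ∀ s : ℝ,
      BddAbove (Set.range fun n => |z n + s * c n|) := by
    rintro z ⟨C, hC⟩ s
    obtain ⟨D, hD⟩ := hcb'
    refine ⟨C + |s| * D, ?_⟩
    rintro _ ⟨n, rfl⟩
    refine (abs_add_le _ _).trans ?_
    rw [abs_mul]
    exact add_le_add (hC ⟨n, rfl⟩) (mul_le_mul_of_nonneg_left (hD ⟨n, rfl⟩) (abs_nonneg s))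
  set Z : ℕ → Ω → ℝ := fun n => Y n - c n • ξ with hZ
  have hZV : ∀ n, Z n ∈ V := fun n => V.sub_mem (hY n) (V.smul_mem _ hξ)
  have hZm : Measurable (fun ω n => Z n ω) :=
    measurable_pi_lambda _ fun n => hV.measurable _ (hZV n)
  have hξm : Measurable ξ := hV.measurable _ hξ
  have hind : IndepFun (fun ω n => Z n ω) ξ P := by
    have hG : IsGaussianProcess (Sum.elim Z fun _ : Unit => ξ) P :=
      hV.isGaussianProcess fun s => by
        cases s with
        | inl n => exact hZV n
        | inr _ => exact hξ
    have := hG.indepFun_of_covariance_eq_zero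
      (fun n => (hV.measurable _ (hZV n)).aemeasurable) (fun _ => hξm.aemeasurable) fun n _ => by
        simp only [hZ]
        rw [covariance_sub_left (hV.memLp_two (hY n)) ((hV.memLp_two hξ).const_smul _)
          (hV.memLp_two hξ), covariance_smul_left, covariance_self hξm.aemeasurable,
          covariance_comm, hcv n, ← hvdef]
        ring
    exact this.comp measurable_id (measurable_pi_apply ())
  set B : Set ((ℕ → ℝ) × ℝ) := {p | BddAbove (Set.range fun n => |p.1 n|) ∧
    ⨆ n, |p.1 n + p.2 * c n| = u ∧ ⨆ n, |p.1 n + (p.2 + v) * c n| < u} with hB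
  have hBm : MeasurableSet B := by
    refine (measurableSet_bddAbove_range fun n => by fun_prop).inter
      ((measurableSet_eq_fun (Measurable.iSup fun n => by fun_prop) measurable_const).inter
        (measurableSet_lt (f := fun p : (ℕ → ℝ) × ℝ => ⨆ n, |p.1 n + (p.2 + v) * c n|)
          (Measurable.iSup fun n => by fun_prop) measurable_const))
  have hYZ : ∀ n ω (r : ℝ), Z n ω + (ξ ω + r) * c n = Y n ω + r * c n := fun n ω r => by
    simp only [hZ, Pi.sub_apply, Pi.smul_apply, smul_eq_mul]
    ring
  have hsub : {ω | ⨆ n, |Y n ω| = u ∧ ⨆ n, |Y n ω + cov[ξ, Y n; P]| < u} ⊆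
      (fun ω => ((fun n => Z n ω), ξ ω)) ⁻¹' B := by
    rintro ω ⟨h1, h2⟩
    have hYZ0 : ∀ n, Z n ω + ξ ω * c n = Y n ω := fun n => by simpa using hYZ n ω 0
    refine ⟨?_, by simpa only [hYZ0] using h1, by simpa only [hYZ, hcv] using h2⟩
    have hZe : ∀ n, Y n ω + -ξ ω * c n = Z n ω := fun n => by rw [← hYZ0 n]; ring
    simpa only [hZe] using hbdd (hYb ω) (-ξ ω)
  refine measure_mono_null hsub ?_
  rw [← Measure.map_apply (hZm.prodMk hξm) hBm,
    (indepFun_iff_map_prod_eq_prod_map_map hZm.aemeasurable hξm.aemeasurable).1 hind,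
    Measure.measure_prod_null hBm]
  refine ae_of_all _ fun z => ?_
  have hss : (Prod.mk z ⁻¹' B).Subsingleton := by
    have key : ∀ s ∈ Prod.mk z ⁻¹' B, ∀ t ∈ Prod.mk z ⁻¹' B, ¬ s < t := by
      rintro s ⟨hz, hs, -⟩ t ⟨-, ht, ht'⟩ hst
      dsimp only at hz hs ht ht'
      have hpos : 0 < t + v - s := by linarith
      set l := v / (t + v - s) with hl
      have hl0 : 0 < l := div_pos hv hpos
      have hl1 : l < 1 := (div_lt_one hpos).2 (by linarith)
      have hcomb : t = l * s + (1 - l) * (t + v) := by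
        rw [hl]; field_simp; ring
      have : ⨆ n, |z n + t * c n| ≤ l * u + (1 - l) * ⨆ n, |z n + (t + v) * c n| := by
        refine ciSup_le fun n => ?_
        have e : z n + t * c n = l * (z n + s * c n) + (1 - l) * (z n + (t + v) * c n) := by
          conv_lhs => rw [hcomb]
          ring
        rw [e]
        refine (abs_add_le _ _).trans ?_
        rw [abs_mul, abs_mul, abs_of_pos hl0, abs_of_pos (sub_pos.2 hl1), ← hs]
        have h1 := le_ciSup (hbdd hz s) n
        have h2 := le_ciSup (hbdd hz (t + v)) n
        have h3 : 0 < 1 - l := sub_pos.2 hl1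
        gcongr
      rw [ht] at this
      nlinarith
    exact fun s hs t ht => le_antisymm (not_lt.1 (key t ht s hs)) (not_lt.1 (key s hs t ht))
  have hna : NullSingletonClass (P.map ξ) := by
    rw [hV.map_eq_gaussianReal hξ]
    exact nullSingletonClass_gaussianReal (by simpa using hv)
  exact hss.measure_zero (P.map ξ)

end IsCenteredGaussianSpace

lemma exists_finset_sum_approx_strongDual {T : Type*} [MetricSpace T] [CompactSpace T]
    (L : StrongDual ℝ C(T, ℝ)) {ε : ℝ} (hε : 0 < ε) :
    ∃ (s : Finset T) (a : T → ℝ), ∀ (f : C(T, ℝ)) (δ : ℝ), 0 ≤ δ →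
      (∀ x y, dist x y < ε → |f x - f y| ≤ δ) → |L f - ∑ x ∈ s, a x * f x| ≤ ‖L‖ * δ := by
  classical
  obtain ⟨t, -, htf, ht⟩ := (isCompact_univ (X := T)).finite_cover_balls hε
  lift t to Finset T using htf
  obtain ⟨φ, hφ⟩ := PartitionOfUnity.exists_isSubordinate isClosed_univ
    (fun i : t => Metric.ball (i : T) ε) (fun i => Metric.isOpen_ball) (by
      simpa [Set.iUnion_subtype] using ht)
  refine ⟨t, fun x => if hx : x ∈ t then L (φ ⟨x, hx⟩) else 0, fun f δ hδ hf => ?_⟩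
  have hsum : ∑ x ∈ t, (if hx : x ∈ t then L (φ ⟨x, hx⟩) else 0) * f x =
      L (∑ i : t, f i • φ i) := by
    rw [map_sum, ← Finset.sum_attach]
    simp [mul_comm]
  rw [hsum, ← map_sub, ← Real.norm_eq_abs]
  refine (L.le_opNorm _).trans (mul_le_mul_of_nonneg_left ?_ (norm_nonneg L))
  refine (ContinuousMap.norm_le _ hδ).2 fun x => ?_
  have h1 : ∑ i, φ i x = 1 := by
    rw [← finsum_eq_sum_of_fintype]
    exact φ.sum_eq_one (Set.mem_univ x)
  have h2 : (f - ∑ i : t, f i • φ i) x = ∑ i, φ i x * (f x - f i) := by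
    simp only [mul_sub, Finset.sum_sub_distrib, ← Finset.sum_mul, h1, one_mul]
    simp [mul_comm]
  rw [h2, Real.norm_eq_abs]
  calc |∑ i, φ i x * (f x - f i)| ≤ ∑ i, |φ i x * (f x - f i)| := Finset.abs_sum_le_sum_abs _ _
    _ ≤ ∑ i, φ i x * δ := by
        refine Finset.sum_le_sum fun i _ => ?_
        rw [abs_mul, abs_of_nonneg (φ.nonneg i x)]
        obtain h0 | h0 := eq_or_ne (φ i x) 0
        · simp [h0]
        · refine mul_le_mul_of_nonneg_left (hf _ _ ?_) (φ.nonneg i x)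
          exact hφ i (subset_tsupport _ h0)
    _ = δ := by rw [← Finset.sum_mul, h1, one_mul]

/-- Every continuous linear functional on `C(T, ℝ)` is a pointwise sequential limit of finite
linear combinations of evaluations. -/
lemma exists_seq_tendsto_strongDual {T : Type*} [MetricSpace T] [CompactSpace T]
    (L : StrongDual ℝ C(T, ℝ)) :
    ∃ (s : ℕ → Finset T) (a : ℕ → T → ℝ), ∀ f : C(T, ℝ),
      Tendsto (fun n => ∑ x ∈ s n, a n x * f x) atTop (𝓝 (L f)) := by
  choose s a h using fun n : ℕ =>
    exists_finset_sum_approx_strongDual L (Nat.one_div_pos_of_nat (α := ℝ) (n := n))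
  refine ⟨s, a, fun f => Metric.tendsto_atTop.2 fun η hη => ?_⟩
  have hpos : 0 < η / (‖L‖ + 1) := by positivity
  obtain ⟨ε, hε, hf⟩ := Metric.uniformContinuous_iff.1
    (CompactSpace.uniformContinuous_of_continuous f.continuous) _ hpos
  obtain ⟨N, hN⟩ := exists_nat_one_div_lt hε
  refine ⟨N, fun n hn => ?_⟩
  rw [dist_comm, Real.dist_eq]
  refine (h n f _ hpos.le fun x y hxy => ?_).trans_lt ?_
  · exact (hf (hxy.trans ((Nat.one_div_le_one_div hn).trans_lt hN))).le
  · rw [← mul_div_assoc, div_lt_iff₀ (by positivity)]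
    nlinarith [norm_nonneg L]

lemma Submodule.exists_strongDual_eq_zero_of_notMem_closure {E : Type*} [NormedAddCommGroup E]
    [NormedSpace ℝ E] (H : Submodule ℝ E) {x : E} (hx : x ∉ closure (H : Set E)) :
    ∃ L : StrongDual ℝ E, (∀ h ∈ H, L h = 0) ∧ L x ≠ 0 := by
  obtain ⟨L, r, hL, hr⟩ := geometric_hahn_banach_closed_point H.convex.closure isClosed_closure hx
  have hr0 : 0 < r := by simpa using hL 0 (subset_closure H.zero_mem)
  refine ⟨L, fun h hh => ?_, (hr0.trans hr).ne'⟩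
  by_contra hne
  have := hL ((r / L h) • h) (subset_closure (H.smul_mem _ hh))
  rw [map_smul, smul_eq_mul, div_mul_cancel₀ _ hne] at this
  exact this.false

lemma IsCenteredGaussianSpace.ae_mem_closure {T : Type*} [MetricSpace T] [CompactSpace T]
    {Ω : Type*} [MeasurableSpace Ω] {P : Measure Ω} [IsProbabilityMeasure P]
    {V : Submodule ℝ (Ω → ℝ)} (hV : IsCenteredGaussianSpace V P) {x : Ω → C(T, ℝ)}
    (hx : ∀ t, (fun ω => x ω t) ∈ V) (H : Submodule ℝ C(T, ℝ))
    (hH : ∀ t, ∃ h ∈ H, ∀ s, h s = cov[fun ω => x ω t, fun ω => x ω s; P]) :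
    ∀ᵐ ω ∂P, x ω ∈ closure (H : Set C(T, ℝ)) := by
  let I := {L : StrongDual ℝ C(T, ℝ) // ∀ h ∈ H, L h = 0}
  have hL0 : ∀ L : I, ∀ᵐ ω ∂P, L.1 (x ω) = 0 := by
    rintro ⟨L, hL⟩
    obtain ⟨s, a, hs⟩ := exists_seq_tendsto_strongDual L
    set ζ : ℕ → Ω → ℝ := fun n => ∑ t ∈ s n, a n t • fun ω => x ω t with hζ
    have hζV : ∀ n, ζ n ∈ V := fun n => V.sum_mem fun t _ => V.smul_mem _ (hx t)
    have hζa : ∀ n ω, ζ n ω = ∑ t ∈ s n, a n t * x ω t := fun n ω => by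
      simp [hζ, Finset.sum_apply]
    refine hV.ae_eq_zero_of_tendsto (ζ := ζ) hζV (fun ω => by simpa only [hζa] using hs (x ω))
      fun m => ?_
    have hcov : ∀ n, cov[ζ m, ζ n; P] = ∑ t ∈ s m, a m t *
        ∑ r ∈ s n, a n r * cov[fun ω => x ω t, fun ω => x ω r; P] := by
      intro n
      have hmem : ∀ k t, MemLp (a k t • fun ω => x ω t) 2 P := fun k t =>
        (hV.memLp_two (hx t)).const_smul _
      simp only [hζ]
      rw [covariance_sum_left' (fun t _ => hmem m t) (hV.memLp_two (hζV n))]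
      refine Finset.sum_congr rfl fun t _ => ?_
      rw [covariance_smul_left, covariance_sum_right' (fun t _ => hmem n t)
        (hV.memLp_two (hx t))]
      simp only [covariance_smul_right]
    simp only [hcov]
    rw [← Finset.sum_const_zero (s := s m)]
    refine tendsto_finsetSum _ fun t _ => ?_
    obtain ⟨h, hh, hht⟩ := hH t
    have := (hs h).const_mul (a m t)
    rw [hL h hh, mul_zero] at this
    simpa only [hht] using this
  obtain ⟨J, hJ, hJU⟩ := TopologicalSpace.isOpen_iUnion_countable
    (fun L : I => {f : C(T, ℝ) | L.1 f ≠ 0})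
    (fun L => isOpen_ne_fun L.1.continuous continuous_const)
  filter_upwards [(ae_ball_iff hJ).2 fun L _ => hL0 L] with ω hω
  by_contra hne
  obtain ⟨L, hLH, hLx⟩ := H.exists_strongDual_eq_zero_of_notMem_closure hne
  have hmem : x ω ∈ ⋃ L : I, {f : C(T, ℝ) | L.1 f ≠ 0} := Set.mem_iUnion.2 ⟨⟨L, hLH⟩, hLx⟩
  rw [← hJU] at hmem
  obtain ⟨L', hL', hne'⟩ := Set.mem_iUnion₂.1 hmem
  exact hne' (hω L' hL')

lemma ContinuousMap.norm_eq_iSup_abs_denseSeq {T : Type*} [MetricSpace T] [CompactSpace T]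
    [Nonempty T] (f : C(T, ℝ)) : ‖f‖ = ⨆ n, |f (TopologicalSpace.denseSeq T n)| := by
  have hb : BddAbove (Set.range fun n => |f (TopologicalSpace.denseSeq T n)|) :=
    ⟨‖f‖, by rintro _ ⟨n, rfl⟩; exact f.norm_coe_le_norm _⟩
  refine le_antisymm ((ContinuousMap.norm_le_of_nonempty f).2 fun t => ?_)
    (ciSup_le fun n => f.norm_coe_le_norm _)
  have hcl : IsClosed {t | ‖f t‖ ≤ ⨆ n, |f (TopologicalSpace.denseSeq T n)|} :=
    isClosed_le f.continuous.norm continuous_const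
  refine (TopologicalSpace.denseRange_denseSeq T).induction_on
    (p := fun t => ‖f t‖ ≤ ⨆ n, |f (TopologicalSpace.denseSeq T n)|) t hcl fun n => ?_
  exact le_ciSup hb n

/-- for a centered Gaussian process with continuous sample paths on a compact
metric space, the random variable `sup_{t ∈ T} |X_t|` has no atoms on `(0, ∞)`: for every
`u > 0`, `ℙ(sup_{t ∈ T} |X_t| = u) = 0`. The centered Gaussian hypothesis is expressed through
the standard characterization: every finite linear combination of values of the process has a
(possibly degenerate) centered real Gaussian distribution. -/
theorem stmt9 {T : Type*} [MetricSpace T] [CompactSpace T] [Nonempty T]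
    {Ω : Type*} [MeasurableSpace Ω] (P : Measure Ω) [IsProbabilityMeasure P]
    (X : T → Ω → ℝ)
    (hmeas : ∀ t, Measurable (X t))
    (hcont : ∀ ω, Continuous fun t => X t ω)
    (hgauss : ∀ (n : ℕ) (t : Fin n → T) (c : Fin n → ℝ), ∃ v : NNReal,
      Measure.map (fun ω => ∑ i, c i * X (t i) ω) P = gaussianReal 0 v)
    (u : ℝ) (hu : 0 < u) :
    P {ω | (⨆ t, |X t ω|) = u} = 0 := by
  set V : Submodule ℝ (Ω → ℝ) := Submodule.span ℝ (Set.range X) with hVdef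
  have hXV : ∀ t, X t ∈ V := fun t => Submodule.subset_span ⟨t, rfl⟩
  have hV : IsCenteredGaussianSpace V P := by
    have hrep : ∀ ξ ∈ V, ∃ (n : ℕ) (c : Fin n → ℝ) (t : Fin n → T),
        ξ = fun ω => ∑ i, c i * X (t i) ω := by
      intro ξ hξ
      obtain ⟨n, c, g, rfl⟩ := Submodule.mem_span_set'.1 hξ
      choose t ht using fun i => (g i).2
      refine ⟨n, c, t, ?_⟩
      ext ω
      simp [Finset.sum_apply, ht]
    refine ⟨fun ξ hξ => ?_, fun ξ hξ => ?_⟩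
    · obtain ⟨n, c, t, rfl⟩ := hrep ξ hξ
      exact Finset.measurable_sum _ fun i _ => (hmeas (t i)).const_mul (c i)
    · obtain ⟨n, c, t, rfl⟩ := hrep ξ hξ
      exact hgauss n t c
  let x : Ω → C(T, ℝ) := fun ω => ⟨fun t => X t ω, hcont ω⟩
  let K : T → C(T, ℝ) := fun t =>
    ⟨fun s => cov[X t, X s; P], hV.continuous_covariance hXV hcont (hXV t)⟩
  set H : Submodule ℝ C(T, ℝ) := Submodule.span ℝ (Set.range K) with hHdef
  have hHcov : ∀ h ∈ H, ∃ ξ ∈ V, ∀ s, h s = cov[ξ, X s; P] := by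
    intro h hh
    induction hh using Submodule.span_induction with
    | mem h hh =>
      obtain ⟨t, rfl⟩ := hh
      exact ⟨X t, hXV t, fun s => rfl⟩
    | zero => exact ⟨0, V.zero_mem, by simp⟩
    | add g h _ _ hg hh =>
      obtain ⟨ξ, hξ, hξg⟩ := hg
      obtain ⟨η, hη, hηh⟩ := hh
      refine ⟨ξ + η, V.add_mem hξ hη, fun s => ?_⟩
      rw [covariance_add_left (hV.memLp_two hξ) (hV.memLp_two hη) (hV.memLp_two (hXV s)),
        ContinuousMap.add_apply, hξg, hηh]
    | smul c h _ hh =>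
      obtain ⟨ξ, hξ, hξh⟩ := hh
      refine ⟨c • ξ, V.smul_mem c hξ, fun s => ?_⟩
      rw [covariance_smul_left, ContinuousMap.smul_apply, hξh, smul_eq_mul]
  have hnull : ∀ h ∈ H, ∀ᵐ ω ∂P, ¬ (‖x ω‖ = u ∧ ‖x ω + h‖ < u) := by
    intro h hh
    obtain ⟨ξ, hξ, hξh⟩ := hHcov h hh
    have hb : ∀ f : C(T, ℝ),
        BddAbove (Set.range fun n => |f (TopologicalSpace.denseSeq T n)|) := fun f =>
      ⟨‖f‖, by rintro _ ⟨n, rfl⟩; exact f.norm_coe_le_norm _⟩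
    have := hV.measure_iSup_eq_and_iSup_add_covariance_lt
      (Y := fun n => X (TopologicalSpace.denseSeq T n)) (fun n => hXV _) hξ (fun ω => hb (x ω))
      (by simpa only [hξh] using hb h) u
    simp only [← hξh] at this
    rw [ae_iff]
    simp only [not_not, ContinuousMap.norm_eq_iSup_abs_denseSeq]
    exact this
  obtain ⟨D, hDH, hDc, hD⟩ :=
    (TopologicalSpace.IsSeparable.of_separableSpace (H : Set C(T, ℝ))).exists_countable_dense_subset
  have hcl := hV.ae_mem_closure (x := x) hXV H fun t => ⟨K t, Submodule.subset_span ⟨t, rfl⟩,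
    fun s => rfl⟩
  have hae : ∀ᵐ ω ∂P, ¬ (⨆ t, |X t ω|) = u := by
    filter_upwards [hcl, (ae_ball_iff hDc).2 fun h hh => hnull h (hDH hh)] with ω hω hωD hωu
    have hneg : -x ω ∈ closure D := by
      have : -x ω ∈ H.topologicalClosure := neg_mem (show x ω ∈ H.topologicalClosure from hω)
      exact closure_minimal hD isClosed_closure this
    obtain ⟨h, hhD, hh⟩ := Metric.mem_closure_iff.1 hneg u hu
    refine hωD h hhD ⟨?_, ?_⟩
    · rw [ContinuousMap.norm_eq_iSup_norm]
      exact hωu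
    · rw [dist_eq_norm, ← norm_neg] at hh
      rwa [show x ω + h = -(-x ω - h) by abel]
  simpa [ae_iff] using hae
end

section
/- Let ℓ be a positive integer and let X = (X_t)_{t ∈ [−1,1]^ℓ} be a centered Gaussian process on a probability space (Ω, ℱ, ℙ) all of whose sample paths t ↦ X_t(ω) are continuously differentiable on [−1,1]^ℓ, and write ∂X/∂x_i for the i-th partial derivative process. Then for every a > 0 and every b_1, …, b_ℓ > 0, ℙ( sup_{t ∈ [−1,1]^ℓ} |X_t| ≤ a and sup_{t ∈ [−1,1]^ℓ} |∂X/∂x_i (t)| ≤ b_i for all i = 1, …, ℓ ) ≥ ℙ( sup_{t ∈ [−1,1]^ℓ} |X_t| ≤ a ) · ∏_{i=1}^{ℓ} ℙ( sup_{t ∈ [−1,1]^ℓ} |∂X/∂x_i (t)| ≤ b_i ). -/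
open Set MeasureTheory ProbabilityTheory

section GaussianCorrelation

open scoped Matrix MatrixOrder

section GaussianLaplace

variable {ι : Type*} [Fintype ι] [DecidableEq ι]

lemma integral_exp_neg_mul_sq_gaussianReal {d : ℝ} (hd : 0 ≤ d) :
    ∫ x, Real.exp (-(d * x ^ 2) / 2) ∂(gaussianReal 0 1) = (√(1 + d))⁻¹ := by
  rw [integral_gaussianReal_eq_integral_smul one_ne_zero]
  have h (x : ℝ) : gaussianPDFReal 0 1 x • Real.exp (-(d * x ^ 2) / 2)
      = (√(2 * Real.pi))⁻¹ * Real.exp (-((1 + d) / 2) * x ^ 2) := by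
    simp only [gaussianPDFReal, smul_eq_mul, NNReal.coe_one, mul_one, sub_zero]
    rw [mul_assoc, ← Real.exp_add]
    congr 2
    ring
  simp_rw [h]
  rw [integral_const_mul, integral_gaussian, ← Real.sqrt_inv, ← Real.sqrt_inv,
    ← Real.sqrt_mul (by positivity)]
  congr 1
  have := Real.pi_pos
  field_simp

lemma Matrix.IsHermitian.dotProduct_mulVec_sum_eigenvectorBasis {S : Matrix ι ι ℝ}
    (hS : S.IsHermitian) (x : ι → ℝ) :
    (∑ i, x i • hS.eigenvectorBasis i).ofLp ⬝ᵥ S *ᵥ (∑ i, x i • hS.eigenvectorBasis i).ofLp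
      = ∑ i, hS.eigenvalues i * x i ^ 2 := by
  set b := hS.eigenvectorBasis
  have h1 : S *ᵥ (∑ i, x i • b i).ofLp = (∑ i, (hS.eigenvalues i * x i) • b i).ofLp := by
    simp only [WithLp.ofLp_sum, WithLp.ofLp_smul, Matrix.mulVec_sum, Matrix.mulVec_smul]
    refine Finset.sum_congr rfl fun i _ => ?_
    rw [hS.mulVec_eigenvectorBasis, smul_smul, mul_comm]
  have h2 (y z : EuclideanSpace ℝ ι) : y.ofLp ⬝ᵥ z.ofLp = inner ℝ y z := by
    rw [EuclideanSpace.inner_eq_star_dotProduct, dotProduct_comm]; simp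
  rw [h1, h2, b.orthonormal.inner_sum]
  refine Finset.sum_congr rfl fun i _ => ?_
  simp
  ring

lemma Matrix.PosSemidef.det_one_add_eq_prod {S : Matrix ι ι ℝ} (hS : S.PosSemidef) :
    (1 + S).det = ∏ i, (1 + hS.1.eigenvalues i) := by
  have h := hS.1.spectral_theorem
  set U := hS.1.eigenvectorUnitary
  have h1 : 1 + S = Unitary.conjStarAlgAut ℝ _ U (1 + Matrix.diagonal hS.1.eigenvalues) := by
    rw [map_add, map_one]
    congr 1
  rw [h1, Unitary.conjStarAlgAut_apply, Matrix.det_mul_right_comm]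
  rw [show (U : Matrix ι ι ℝ) * star (U : Matrix ι ι ℝ) = 1 from Unitary.mul_star_self_of_mem U.2,
    one_mul, ← Matrix.diagonal_one, Matrix.diagonal_add, Matrix.det_diagonal]

lemma integral_exp_neg_quadratic_stdGaussian {S : Matrix ι ι ℝ} (hS : S.PosSemidef) :
    ∫ x, Real.exp (-(x.ofLp ⬝ᵥ S *ᵥ x.ofLp) / 2) ∂(stdGaussian (EuclideanSpace ℝ ι))
      = (√(1 + S).det)⁻¹ := by
  rw [stdGaussian_eq_map_pi_orthonormalBasis hS.1.eigenvectorBasis,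
    integral_map (Continuous.aemeasurable (by fun_prop)) (by
      apply Continuous.aestronglyMeasurable
      simp only [dotProduct, Matrix.mulVec]
      fun_prop)]
  simp_rw [hS.1.dotProduct_mulVec_sum_eigenvectorBasis, ← Finset.sum_neg_distrib, Finset.sum_div,
    Real.exp_sum]
  rw [integral_fintype_prod_eq_prod
    (f := fun i (x : ℝ) => Real.exp (-(hS.1.eigenvalues i * x ^ 2) / 2)), hS.det_one_add_eq_prod,
    Real.sqrt_eq_rpow, ← Real.finsetProd_rpow _ _
      (fun i _ => add_nonneg zero_le_one (hS.eigenvalues_nonneg i)), ← Finset.prod_inv_distrib]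
  refine Finset.prod_congr rfl fun i _ => ?_
  rw [integral_exp_neg_mul_sq_gaussianReal (hS.eigenvalues_nonneg i), Real.sqrt_eq_rpow]

/-- The Laplace transform of the squared coordinates of a centered Gaussian vector. -/
lemma integral_exp_neg_diagonal_multivariateGaussian {C : Matrix ι ι ℝ} (hC : C.PosSemidef)
    {k : ι → ℝ} (hk : ∀ i, 0 ≤ k i) :
    ∫ x, Real.exp (-(∑ i, k i * x.ofLp i ^ 2) / 2) ∂(multivariateGaussian 0 C)
      = (√(1 + Matrix.diagonal k * C).det)⁻¹ := by
  obtain ⟨A, hA_def⟩ : ∃ A, A = CFC.sqrt C := ⟨_, rfl⟩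
  have hA : A * A = C := hA_def ▸ CFC.sqrt_mul_sqrt_self _ hC.nonneg
  have hAt : Aᵀ = A := by
    simpa [Matrix.IsHermitian, hA_def] using
      (Matrix.nonneg_iff_posSemidef.1 (CFC.sqrt_nonneg C)).1
  have hS : (A * Matrix.diagonal k * A).PosSemidef := by
    have := (Matrix.PosSemidef.diagonal (n := ι) (R := ℝ) hk).conjTranspose_mul_mul_same A
    rwa [Matrix.conjTranspose_eq_transpose_of_trivial, hAt] at this
  rw [multivariateGaussian, ← hA_def, integral_map (by fun_prop) (by
      apply Continuous.aestronglyMeasurable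
      fun_prop)]
  have hq (x : EuclideanSpace ℝ ι) :
      ∑ i, k i * ((0 + Matrix.toEuclideanCLM (𝕜 := ℝ) A x : EuclideanSpace ℝ ι).ofLp i) ^ 2
        = x.ofLp ⬝ᵥ (A * Matrix.diagonal k * A) *ᵥ x.ofLp := by
    rw [zero_add, Matrix.ofLp_toEuclideanCLM, ← Matrix.mulVec_mulVec, ← Matrix.mulVec_mulVec,
      Matrix.dotProduct_mulVec, ← Matrix.mulVec_transpose, hAt]
    simp only [dotProduct, Matrix.mulVec_diagonal]
    exact Finset.sum_congr rfl fun i _ => by ring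
  simp_rw [hq]
  rw [integral_exp_neg_quadratic_stdGaussian hS, mul_assoc, Matrix.det_one_add_mul_comm, mul_assoc,
    hA]

end GaussianLaplace

section SignInterpolation

variable {ι : Type*} [Fintype ι] [DecidableEq ι]

/-- For a vector of signs `s`, the matrix obtained from `C` by multiplying the entries `C i j`
with `s i ≠ s j` by `t`. -/
noncomputable def Matrix.signInterp (s : ι → ℝ) (C : Matrix ι ι ℝ) (t : ℝ) : Matrix ι ι ℝ :=
  ((1 + t) / 2) • C + ((1 - t) / 2) • (Matrix.diagonal s * C * Matrix.diagonal s)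

namespace Matrix

lemma signInterp_apply (s : ι → ℝ) (C : Matrix ι ι ℝ) (t : ℝ) (i j : ι) :
    signInterp s C t i j = (1 + t) / 2 * C i j + (1 - t) / 2 * (s i * C i j * s j) := by
  simp [signInterp]

lemma signInterp_one (s : ι → ℝ) (C : Matrix ι ι ℝ) : signInterp s C 1 = C := by
  simp [signInterp]

lemma PosSemidef.diagonal_mul_mul_diagonal {C : Matrix ι ι ℝ} (hC : C.PosSemidef) (r : ι → ℝ) :
    (diagonal r * C * diagonal r).PosSemidef := by
  simpa using hC.conjTranspose_mul_mul_same (diagonal r)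

lemma PosSemidef.posSemidef_signInterp {C : Matrix ι ι ℝ} (hC : C.PosSemidef) (s : ι → ℝ) {t : ℝ}
    (ht : t ∈ Icc (-1 : ℝ) 1) : (signInterp s C t).PosSemidef :=
  (hC.smul (by linarith [ht.1])).add
    ((hC.diagonal_mul_mul_diagonal s).smul (by linarith [ht.2]))

lemma signInterp_neg {s : ι → ℝ} (hs : ∀ i, s i * s i = 1) (C : Matrix ι ι ℝ) (t : ℝ) :
    signInterp s C (-t) = diagonal s * signInterp s C t * diagonal s := by
  ext i j
  simp only [signInterp_apply, mul_diagonal, diagonal_mul]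
  linear_combination (-(1 - t) / 2 * C i j) * hs i + (-(1 - t) / 2 * C i j * s i * s i) * hs j

lemma diagonal_mul_signInterp_mul_diagonal (s r : ι → ℝ) (C : Matrix ι ι ℝ) (t : ℝ) :
    diagonal r * signInterp s C t * diagonal r
      = signInterp s (diagonal r * C * diagonal r) t := by
  ext i j
  simp only [signInterp_apply, mul_diagonal, diagonal_mul]
  ring

lemma det_one_add_diagonal_mul {k : ι → ℝ} (hk : ∀ i, 0 ≤ k i) (C : Matrix ι ι ℝ) :
    (1 + diagonal k * C).det
      = (1 + diagonal (fun i => √(k i)) * C * diagonal (fun i => √(k i))).det := by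
  rw [det_one_add_mul_comm (diagonal (fun i => √(k i)) * C), ← mul_assoc, diagonal_mul_diagonal]
  simp_rw [Real.mul_self_sqrt (hk _)]

lemma PosSemidef.det_one_add_pos {C : Matrix ι ι ℝ} (hC : C.PosSemidef) : 0 < (1 + C).det := by
  rw [hC.det_one_add_eq_prod]
  exact Finset.prod_pos fun i _ => by linarith [hC.eigenvalues_nonneg i]

lemma PosSemidef.det_one_add_diagonal_mul_pos {C : Matrix ι ι ℝ} (hC : C.PosSemidef) {k : ι → ℝ}
    (hk : ∀ i, 0 ≤ k i) : 0 < (1 + diagonal k * C).det := by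
  rw [det_one_add_diagonal_mul hk]
  exact (hC.diagonal_mul_mul_diagonal _).det_one_add_pos

omit [DecidableEq ι] in
lemma PosSemidef.integrable_exp_neg_quadratic {C : Matrix ι ι ℝ} (hC : C.PosSemidef) :
    Integrable (fun x : EuclideanSpace ℝ ι => Real.exp (-(x.ofLp ⬝ᵥ C *ᵥ x.ofLp) / 2))
      (stdGaussian (EuclideanSpace ℝ ι)) := by
  refine Integrable.of_bound (C := 1) ?_ (Filter.Eventually.of_forall fun x => ?_)
  · apply Continuous.aestronglyMeasurable
    simp only [dotProduct, mulVec]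
    fun_prop
  · rw [Real.norm_eq_abs, Real.abs_exp, Real.exp_le_one_iff]
    have := hC.dotProduct_mulVec_nonneg x.ofLp
    simp only [star_trivial] at this
    linarith

lemma PosSemidef.det_one_add_signInterp_antitoneOn {C : Matrix ι ι ℝ} (hC : C.PosSemidef)
    {s : ι → ℝ} (hs : ∀ i, s i * s i = 1) :
    AntitoneOn (fun t => (1 + signInterp s C t).det) (Icc 0 1) := by
  intro u hu t ht hut
  have hsd {r : ℝ} (hr : r ∈ Icc (0 : ℝ) 1) : (signInterp s C r).PosSemidef :=
    hC.posSemidef_signInterp s ⟨by linarith [hr.1], hr.2⟩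
  have hneg : (signInterp s C (-t)).PosSemidef :=
    hC.posSemidef_signInterp s ⟨by linarith [ht.2], by linarith [ht.1]⟩
  have hss : diagonal s * diagonal s = 1 := by
    simp [diagonal_mul_diagonal, hs]
  have heven : (1 + signInterp s C (-t)).det = (1 + signInterp s C t).det := by
    rw [signInterp_neg hs, det_one_add_mul_comm, ← mul_assoc, hss, one_mul]
  suffices h : (√(1 + signInterp s C u).det)⁻¹ ≤ (√(1 + signInterp s C t).det)⁻¹ by
    have h1 := (hsd hu).det_one_add_pos
    have h2 := (hsd ht).det_one_add_pos
    rw [inv_le_inv₀ (Real.sqrt_pos.2 h1) (Real.sqrt_pos.2 h2)] at h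
    exact (Real.sqrt_le_sqrt_iff h1.le).1 h
  obtain ⟨a, ha0, ha1, hau⟩ : ∃ a : ℝ, 0 ≤ a ∧ a ≤ 1 ∧ u = a * t + (1 - a) * (-t) := by
    rcases ht.1.eq_or_lt with h0 | h0
    · exact ⟨0, le_rfl, zero_le_one, by linarith [hu.1]⟩
    · refine ⟨(u + t) / (2 * t), div_nonneg (by linarith [hu.1]) (by linarith), ?_, ?_⟩
      · rw [div_le_one (by linarith)]; linarith
      · field_simp; ring
  have hlin : signInterp s C u = a • signInterp s C t + (1 - a) • signInterp s C (-t) := by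
    ext i j
    simp only [signInterp_apply, add_apply, smul_apply, smul_eq_mul, hau]
    ring
  have hint := (((hsd ht).integrable_exp_neg_quadratic).const_mul a).add
    ((hneg.integrable_exp_neg_quadratic).const_mul (1 - a))
  calc (√(1 + signInterp s C u).det)⁻¹
      = ∫ x, Real.exp (-(x.ofLp ⬝ᵥ signInterp s C u *ᵥ x.ofLp) / 2)
          ∂(stdGaussian (EuclideanSpace ℝ ι)) :=
        (integral_exp_neg_quadratic_stdGaussian (hsd hu)).symm
    _ ≤ ∫ x, (a * Real.exp (-(x.ofLp ⬝ᵥ signInterp s C t *ᵥ x.ofLp) / 2)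
          + (1 - a) * Real.exp (-(x.ofLp ⬝ᵥ signInterp s C (-t) *ᵥ x.ofLp) / 2))
          ∂(stdGaussian (EuclideanSpace ℝ ι)) := by
        refine integral_mono (hsd hu).integrable_exp_neg_quadratic hint fun x => ?_
        have := convexOn_exp.2 (mem_univ (-(x.ofLp ⬝ᵥ signInterp s C t *ᵥ x.ofLp) / 2))
          (mem_univ (-(x.ofLp ⬝ᵥ signInterp s C (-t) *ᵥ x.ofLp) / 2)) ha0
          (sub_nonneg.2 ha1) (by ring)
        simp only [smul_eq_mul] at this
        refine le_trans (le_of_eq ?_) this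
        congr 1
        rw [hlin, add_mulVec, dotProduct_add, smul_mulVec, smul_mulVec, dotProduct_smul,
          dotProduct_smul]
        simp only [smul_eq_mul]
        ring
    _ = (√(1 + signInterp s C t).det)⁻¹ := by
        rw [integral_add (((hsd ht).integrable_exp_neg_quadratic).const_mul a)
          ((hneg.integrable_exp_neg_quadratic).const_mul (1 - a)), integral_const_mul,
          integral_const_mul, integral_exp_neg_quadratic_stdGaussian (hsd ht),
          integral_exp_neg_quadratic_stdGaussian hneg, heven]
        ring

lemma PosSemidef.det_one_add_diagonal_mul_signInterp_antitoneOn {C : Matrix ι ι ℝ}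
    (hC : C.PosSemidef) {s : ι → ℝ} (hs : ∀ i, s i * s i = 1) {k : ι → ℝ} (hk : ∀ i, 0 ≤ k i) :
    AntitoneOn (fun t => (1 + diagonal k * signInterp s C t).det) (Icc 0 1) := by
  simp_rw [det_one_add_diagonal_mul hk, diagonal_mul_signInterp_mul_diagonal]
  exact (hC.diagonal_mul_mul_diagonal _).det_one_add_signInterp_antitoneOn hs

/-- The principal minor of `C` on the rows and columns in `J`, as the determinant of the matrix with
the rows of `C` in `J` and the rows of the identity outside. -/
noncomputable def principalMinor (C : Matrix ι ι ℝ) (J : Finset ι) : ℝ :=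
  (of fun i j => if i ∈ J then C i j else (1 : Matrix ι ι ℝ) i j).det

lemma det_one_add_diagonal_mul_eq_sum (k : ι → ℝ) (C : Matrix ι ι ℝ) :
    (1 + diagonal k * C).det
      = ∑ J : Finset ι, (∏ i, if i ∈ J then k i else 1) * principalMinor C J := by
  have h := (detRowAlternating (n := ι) (R := ℝ)).toMultilinearMap.map_add_univ
    (fun i => (diagonal k * C) i) (fun i => (1 : Matrix ι ι ℝ) i)
  rw [add_comm]
  refine h.trans (Finset.sum_congr rfl fun J _ => ?_)
  rw [principalMinor, ← det_mul_column]
  refine congrArg det ?_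
  ext i j
  by_cases hi : i ∈ J <;> simp [hi, Finset.piecewise]

lemma PosSemidef.principalMinor_signInterp_antitoneOn {C : Matrix ι ι ℝ}
    (hC : C.PosSemidef) {s : ι → ℝ} (hs : ∀ i, s i * s i = 1) (J : Finset ι) :
    AntitoneOn (fun t => principalMinor (signInterp s C t) J) (Icc 0 1) := by
  intro u hu t ht hut
  let f (r : ℝ) (ε : ℝ) : ℝ :=
    (diagonal (fun i => if i ∈ J then ε else 1) +
      diagonal (fun i => if i ∈ J then 1 else 0) * signInterp s C r).det
  have hf0 (r : ℝ) : f r 0 = principalMinor (signInterp s C r) J := by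
    refine congrArg det ?_
    ext i j
    simp only [of_apply, add_apply, diagonal_mul, diagonal_apply, one_apply]
    split_ifs <;> simp
  have hfcont (r : ℝ) : Continuous (f r) := by
    refine Continuous.matrix_det (Continuous.add ?_ continuous_const)
    refine Continuous.matrix_diagonal (continuous_pi fun i => ?_)
    split_ifs <;> fun_prop
  have hlim (r : ℝ) : Filter.Tendsto (f r) (nhdsWithin 0 (Ioi 0))
      (nhds (principalMinor (signInterp s C r) J)) := by
    rw [← hf0]
    exact ((hfcont r).tendsto 0).mono_left nhdsWithin_le_nhds
  refine le_of_tendsto_of_tendsto (hlim t) (hlim u) ?_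
  filter_upwards [self_mem_nhdsWithin] with ε hε
  have hε' : (0 : ℝ) < ε := hε
  have hfac (r : ℝ) : f r ε = (diagonal (fun i => if i ∈ J then ε else 1)).det *
      (1 + diagonal (fun i => if i ∈ J then ε⁻¹ else 0) * signInterp s C r).det := by
    rw [← det_mul, mul_add, mul_one, ← mul_assoc, diagonal_mul_diagonal]
    refine congrArg det ?_
    congr 3
    ext i
    split_ifs <;> simp [hε'.ne']
  simp only [hfac]
  refine mul_le_mul_of_nonneg_left ?_ ?_
  · exact hC.det_one_add_diagonal_mul_signInterp_antitoneOn hs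
      (fun i => by split_ifs <;> positivity) hu ht hut
  · rw [det_diagonal]
    exact Finset.prod_nonneg fun i _ => by split_ifs <;> positivity

lemma differentiable_principalMinor_signInterp (C : Matrix ι ι ℝ) (s : ι → ℝ) (J : Finset ι) :
    Differentiable ℝ (fun t => principalMinor (signInterp s C t) J) := by
  simp only [principalMinor, det_apply, of_apply, signInterp_apply]
  refine Differentiable.fun_sum fun σ _ => Differentiable.const_smul ?_ _
  refine Differentiable.fun_finsetProd fun i _ => ?_
  split_ifs <;> fun_prop

lemma PosSemidef.deriv_principalMinor_signInterp_nonpos {C : Matrix ι ι ℝ}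
    (hC : C.PosSemidef) {s : ι → ℝ} (hs : ∀ i, s i * s i = 1) (J : Finset ι) {t : ℝ}
    (ht : t ∈ Ioo (0 : ℝ) 1) : deriv (fun t => principalMinor (signInterp s C t) J) t ≤ 0 := by
  rw [← derivWithin_of_mem_nhds (Icc_mem_nhds ht.1 ht.2)]
  exact (hC.principalMinor_signInterp_antitoneOn hs J).derivWithin_nonpos

end Matrix

end SignInterpolation

section PolynomialTest

variable {ι : Type*} [Fintype ι] [DecidableEq ι]

lemma integral_prod_sum_pow {Ω : Type*} [MeasurableSpace Ω] (μ : Measure Ω) [IsFiniteMeasure μ]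
    {u : ι → Ω → ℝ} (hu : ∀ i, Measurable (u i)) (h01 : ∀ i ω, u i ω ∈ Icc (0 : ℝ) 1) (N : ℕ)
    (c : ι → ℕ → ℝ) :
    ∫ ω, ∏ i, ∑ m ∈ Finset.range N, c i m * u i ω ^ m ∂μ
      = ∑ k ∈ Fintype.piFinset (fun _ : ι => Finset.range N),
          (∏ i, c i (k i)) * ∫ ω, ∏ i, u i ω ^ (k i) ∂μ := by
  simp_rw [Finset.prod_univ_sum, Finset.prod_mul_distrib]
  rw [integral_finsetSum]
  · simp_rw [integral_const_mul]
  · intro k _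
    refine Integrable.const_mul (Integrable.of_bound (C := 1) ?_ ?_) _
    · exact (Finset.measurable_prod _ fun i _ => (hu i).pow_const _).aestronglyMeasurable
    · refine Filter.Eventually.of_forall fun ω => ?_
      rw [Real.norm_eq_abs, abs_of_nonneg (Finset.prod_nonneg fun i _ => pow_nonneg (h01 i ω).1 _)]
      exact Finset.prod_le_one (fun i _ => pow_nonneg (h01 i ω).1 _)
        fun i _ => pow_le_one₀ (h01 i ω).1 (h01 i ω).2

lemma Real.exp_neg_sq_div_two_mem_Icc (x : ℝ) : Real.exp (-x ^ 2 / 2) ∈ Icc (0 : ℝ) 1 :=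
  ⟨(Real.exp_pos _).le, Real.exp_le_one_iff.2 (by nlinarith [sq_nonneg x])⟩

lemma integral_prod_exp_pow_multivariateGaussian {C : Matrix ι ι ℝ} (hC : C.PosSemidef)
    (k : ι → ℕ) :
    ∫ x, ∏ i, Real.exp (-x.ofLp i ^ 2 / 2) ^ k i ∂(multivariateGaussian 0 C)
      = (√(1 + Matrix.diagonal (fun i => (k i : ℝ)) * C).det)⁻¹ := by
  rw [← integral_exp_neg_diagonal_multivariateGaussian hC (fun i => Nat.cast_nonneg (k i))]
  refine integral_congr_ae (Filter.Eventually.of_forall fun x => ?_)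
  simp only [← Real.exp_nat_mul, ← Real.exp_sum, ← Finset.sum_neg_distrib, Finset.sum_div]
  congr 1
  refine Finset.sum_congr rfl fun i _ => by ring

lemma integral_prod_sum_exp_pow_multivariateGaussian {C : Matrix ι ι ℝ} (hC : C.PosSemidef)
    (N : ℕ) (c : ι → ℕ → ℝ) :
    ∫ x, ∏ i, ∑ m ∈ Finset.range N, c i m * Real.exp (-x.ofLp i ^ 2 / 2) ^ m
        ∂(multivariateGaussian 0 C)
      = ∑ k ∈ Fintype.piFinset (fun _ : ι => Finset.range N), (∏ i, c i (k i)) *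
          (√(1 + Matrix.diagonal (fun i => (k i : ℝ)) * C).det)⁻¹ := by
  rw [integral_prod_sum_pow (u := fun i (x : EuclideanSpace ℝ ι) => Real.exp (-x.ofLp i ^ 2 / 2)) _
    (fun i => by fun_prop) (fun i x => Real.exp_neg_sq_div_two_mem_Icc _)]
  simp_rw [integral_prod_exp_pow_multivariateGaussian hC]

/-- The Laplace transform of half the sum of squares of three independent copies of a centered
Gaussian vector, applied to products of nonnegative polynomials, is nonnegative. -/
lemma sum_prod_mul_inv_sqrt_det_pow_three_nonneg {C : Matrix ι ι ℝ} (hC : C.PosSemidef)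
    {N : ℕ} {c : ι → ℕ → ℝ}
    (hc : ∀ i, ∀ u ∈ Icc (0 : ℝ) 1, 0 ≤ ∑ m ∈ Finset.range N, c i m * u ^ m) :
    0 ≤ ∑ k ∈ Fintype.piFinset (fun _ : ι => Finset.range N), (∏ i, c i (k i)) *
          (√(1 + Matrix.diagonal (fun i => (k i : ℝ)) * C).det)⁻¹ ^ 3 := by
  let μ := multivariateGaussian 0 C
  let g (i : ι) (x : EuclideanSpace ℝ ι) : ℝ := Real.exp (-x.ofLp i ^ 2 / 2)
  have hg (i x) : g i x ∈ Icc (0 : ℝ) 1 := Real.exp_neg_sq_div_two_mem_Icc _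
  have hgm (i) : Measurable (g i) := by fun_prop
  let u (i : ι) (p : EuclideanSpace ℝ ι × EuclideanSpace ℝ ι × EuclideanSpace ℝ ι) : ℝ :=
    g i p.1 * (g i p.2.1 * g i p.2.2)
  have hu (i p) : u i p ∈ Icc (0 : ℝ) 1 :=
    unitInterval.mul_mem (hg _ _) (unitInterval.mul_mem (hg _ _) (hg _ _))
  have h := integral_prod_sum_pow (μ.prod (μ.prod μ)) (u := u) (fun i => by fun_prop) hu N c
  have hk (k : ι → ℕ) : ∫ p, ∏ i, u i p ^ k i ∂(μ.prod (μ.prod μ))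
      = (√(1 + Matrix.diagonal (fun i => (k i : ℝ)) * C).det)⁻¹ ^ 3 := by
    simp only [u, mul_pow, Finset.prod_mul_distrib]
    rw [integral_prod_mul (μ := μ) (ν := μ.prod μ) (fun x => ∏ i, g i x ^ k i)
      (fun p => (∏ i, g i p.1 ^ k i) * ∏ i, g i p.2 ^ k i),
      integral_prod_mul (μ := μ) (ν := μ) (fun x => ∏ i, g i x ^ k i)
        (fun x => ∏ i, g i x ^ k i), integral_prod_exp_pow_multivariateGaussian hC]
    ring
  simp_rw [hk] at h
  rw [← h]
  exact integral_nonneg fun p => Finset.prod_nonneg fun i _ => hc i _ (hu i p)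

open Matrix in
lemma monotoneOn_sum_prod_mul_inv_sqrt_det {C : Matrix ι ι ℝ} (hC : C.PosSemidef)
    {s : ι → ℝ} (hs : ∀ i, s i * s i = 1) {N : ℕ} {c : ι → ℕ → ℝ}
    (hc : ∀ i, ∀ u ∈ Icc (0 : ℝ) 1, 0 ≤ ∑ m ∈ Finset.range N, c i m * u ^ m)
    (hc' : ∀ i, ∀ u ∈ Icc (0 : ℝ) 1, 0 ≤ ∑ m ∈ Finset.range N, c i m * m * u ^ m) :
    MonotoneOn (fun t => ∑ k ∈ Fintype.piFinset (fun _ : ι => Finset.range N), (∏ i, c i (k i)) *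
      (√(1 + diagonal (fun i => (k i : ℝ)) * signInterp s C t).det)⁻¹) (Icc 0 1) := by
  have hpsd {t : ℝ} (ht : t ∈ Icc (0 : ℝ) 1) : (signInterp s C t).PosSemidef :=
    hC.posSemidef_signInterp s ⟨by linarith [ht.1], ht.2⟩
  let M (J : Finset ι) (t : ℝ) : ℝ := principalMinor (signInterp s C t) J
  let w (J : Finset ι) (k : ι → ℕ) : ℝ := ∏ i, if i ∈ J then (k i : ℝ) else 1
  let d (k : ι → ℕ) (t : ℝ) : ℝ := (1 + diagonal (fun i => (k i : ℝ)) * signInterp s C t).det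
  have hd_pos (k : ι → ℕ) {t : ℝ} (ht : t ∈ Icc (0 : ℝ) 1) : 0 < d k t :=
    (hpsd ht).det_one_add_diagonal_mul_pos fun i => Nat.cast_nonneg _
  have hd (k : ι → ℕ) (t : ℝ) : HasDerivAt (d k) (∑ J, w J k * deriv (M J) t) t := by
    have : d k = fun t => ∑ J, w J k * M J t := funext fun t => det_one_add_diagonal_mul_eq_sum _ _
    rw [this]
    exact HasDerivAt.fun_sum fun J _ =>
      ((differentiable_principalMinor_signInterp C s J t).hasDerivAt).const_mul _
  have hF {t : ℝ} (ht : t ∈ Icc (0 : ℝ) 1) :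
      HasDerivAt (fun t => ∑ k ∈ Fintype.piFinset (fun _ : ι => Finset.range N),
          (∏ i, c i (k i)) * (√(d k t))⁻¹)
        (∑ k ∈ Fintype.piFinset (fun _ : ι => Finset.range N),
          (∏ i, c i (k i)) * (-((∑ J, w J k * deriv (M J) t) / (2 * √(d k t))) / √(d k t) ^ 2))
        t :=
    HasDerivAt.fun_sum fun k _ =>
      (((hd k t).sqrt (hd_pos k ht).ne').fun_inv (Real.sqrt_pos.2 (hd_pos k ht)).ne').const_mul _
  refine monotoneOn_of_deriv_nonneg (convex_Icc 0 1)
    (fun t ht => (hF ht).continuousAt.continuousWithinAt)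
    (fun t ht => (hF (interior_subset ht)).differentiableAt.differentiableWithinAt)
    fun t ht => ?_
  rw [(hF (interior_subset ht)).deriv]
  rw [interior_Icc] at ht
  have hexp : ∑ k ∈ Fintype.piFinset (fun _ : ι => Finset.range N),
      (∏ i, c i (k i)) * (-((∑ J, w J k * deriv (M J) t) / (2 * √(d k t))) / √(d k t) ^ 2)
      = ∑ J, -(deriv (M J) t) / 2 * ∑ k ∈ Fintype.piFinset (fun _ : ι => Finset.range N),
          (∏ i, c i (k i) * if i ∈ J then (k i : ℝ) else 1) * (√(d k t))⁻¹ ^ 3 := by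
    simp_rw [Finset.mul_sum]
    rw [Finset.sum_comm]
    refine Finset.sum_congr rfl fun k _ => ?_
    have hpos := Real.sqrt_pos.2 (hd_pos k (Ioo_subset_Icc_self ht))
    rw [Finset.sum_div, ← Finset.sum_neg_distrib, Finset.sum_div, Finset.mul_sum]
    refine Finset.sum_congr rfl fun J _ => ?_
    rw [Finset.prod_mul_distrib]
    simp only [w]
    field_simp
  rw [hexp]
  refine Finset.sum_nonneg fun J _ => mul_nonneg ?_ ?_
  · linarith [hC.deriv_principalMinor_signInterp_nonpos hs J ht]
  · refine sum_prod_mul_inv_sqrt_det_pow_three_nonneg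
      (c := fun i m => c i m * if i ∈ J then (m : ℝ) else 1) (hpsd (Ioo_subset_Icc_self ht))
      fun i u hu => ?_
    by_cases hi : i ∈ J
    · simpa [hi] using hc' i u hu
    · simpa [hi] using hc i u hu

open Matrix in
lemma det_one_add_diagonal_mul_signInterp_zero (C : Matrix ι ι ℝ) (σ : ι → Prop)
    [DecidablePred σ] (k : ι → ℝ) :
    (1 + diagonal k * signInterp (fun i => if σ i then 1 else -1) C 0).det
      = (1 + diagonal (fun i => if σ i then k i else 0) * C).det
        * (1 + diagonal (fun i => if σ i then 0 else k i) * C).det := by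
  set B := signInterp (fun i => if σ i then 1 else -1) C 0
  have hred (q : ι → ℝ) (τ : ι → Prop) [DecidablePred τ]
      (hτ : ∀ i j, τ i → τ j → B i j = C i j) :
      (1 + diagonal (fun i => if τ i then q i else 0) * C).det
        = (1 + diagonal (fun i => if τ i then q i else 0) * B).det := by
    let e : Matrix ι ι ℝ := diagonal fun i => if τ i then 1 else 0
    have hq : diagonal (fun i => if τ i then q i else 0)
        = e * diagonal (fun i => if τ i then q i else 0) := by
      rw [diagonal_mul_diagonal]
      congr 1
      ext i
      split_ifs <;> simp
    have hcomp : diagonal (fun i => if τ i then q i else 0) * C * e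
        = diagonal (fun i => if τ i then q i else 0) * B * e := by
      ext i j
      simp only [e, mul_diagonal, diagonal_mul]
      by_cases hi : τ i <;> by_cases hj : τ j <;> simp [hi, hj]
      left
      exact (hτ i j hi hj).symm
    rw [hq, mul_assoc, mul_assoc, det_one_add_mul_comm, hcomp, ← det_one_add_mul_comm]
  rw [hred k σ, show (fun i => if σ i then 0 else k i) = fun i => if ¬ σ i then k i else 0 by
    ext i; by_cases hi : σ i <;> simp [hi], hred k fun i => ¬ σ i, ← det_mul]
  · congr 1
    ext i j
    simp only [mul_add, add_mul, mul_one, one_mul, Matrix.add_apply, diagonal_mul]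
    have hzero : (diagonal (fun i => if σ i then k i else 0) * B *
        (diagonal (fun i => if ¬ σ i then k i else 0) * B)) i j = 0 := by
      rw [← mul_assoc, mul_apply]
      refine Finset.sum_eq_zero fun l _ => ?_
      rw [mul_diagonal, diagonal_mul]
      by_cases hi : σ i <;> by_cases hl : σ l <;> simp [hi, hl, B, signInterp_apply]
    rw [hzero]
    by_cases hi : σ i <;> simp [hi]
  · intro i j hi hj
    simp only [B, signInterp_apply, hi, hj]
    simp; ring
  · intro i j hi hj
    simp only [B, signInterp_apply, hi, hj]
    simp; ring

/-- The Gaussian correlation inequality for products of nondecreasing polynomials in the variables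
`exp (-x i ^ 2 / 2)`. -/
lemma integral_prod_mul_integral_prod_le_multivariateGaussian {C : Matrix ι ι ℝ}
    (hC : C.PosSemidef) (σ : ι → Prop) [DecidablePred σ] (p : ι → Polynomial ℝ)
    (hp : ∀ i, ∀ u ∈ Icc (0 : ℝ) 1, 0 ≤ (p i).eval u)
    (hp' : ∀ i, ∀ u ∈ Icc (0 : ℝ) 1, 0 ≤ (p i).derivative.eval u) :
    (∫ x, ∏ i, (if σ i then (p i).eval (Real.exp (-x.ofLp i ^ 2 / 2)) else 1)
        ∂(multivariateGaussian 0 C)) *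
      (∫ x, ∏ i, (if σ i then 1 else (p i).eval (Real.exp (-x.ofLp i ^ 2 / 2)))
        ∂(multivariateGaussian 0 C))
      ≤ ∫ x, ∏ i, (p i).eval (Real.exp (-x.ofLp i ^ 2 / 2)) ∂(multivariateGaussian 0 C) := by
  set μ := multivariateGaussian 0 C
  obtain ⟨N, hN⟩ : ∃ N, ∀ i, (p i).natDegree < N :=
    ⟨(∑ i, (p i).natDegree) + 1, fun i => Nat.lt_succ_of_le
      (Finset.single_le_sum (f := fun i => (p i).natDegree) (fun _ _ => Nat.zero_le _)
        (Finset.mem_univ i))⟩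
  have heval (i) (u : ℝ) :
      (p i).eval u = ∑ m ∈ Finset.range N, (p i).coeff m * u ^ m :=
    Polynomial.eval_eq_sum_range' (hN i) u
  have heval' (i) (u : ℝ) :
      u * (p i).derivative.eval u = ∑ m ∈ Finset.range N, (p i).coeff m * m * u ^ m := by
    rw [Polynomial.derivative_eval, Polynomial.sum_over_range' _ (by simp) N (hN i),
      Finset.mul_sum]
    refine Finset.sum_congr rfl fun m _ => ?_
    rcases m with _ | m
    · simp
    · simp only [Nat.add_sub_cancel]; ring
  have hs (i) : (if σ i then (1 : ℝ) else -1) * (if σ i then (1 : ℝ) else -1) = 1 := by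
    split_ifs <;> norm_num
  have hmono := monotoneOn_sum_prod_mul_inv_sqrt_det hC (s := fun i => if σ i then 1 else -1) hs
    (N := N) (c := fun i m => (p i).coeff m) (fun i u hu => (heval i u) ▸ hp i u hu)
    (fun i u hu => (heval' i u) ▸ mul_nonneg hu.1 (hp' i u hu))
    (left_mem_Icc.2 zero_le_one) (right_mem_Icc.2 zero_le_one) zero_le_one
  simp only [Matrix.signInterp_one] at hmono
  rw [← integral_prod_sum_exp_pow_multivariateGaussian hC] at hmono
  simp_rw [← heval] at hmono
  refine le_trans (le_of_eq ?_) hmono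
  let g (i : ι) (x : EuclideanSpace ℝ ι) : ℝ := Real.exp (-x.ofLp i ^ 2 / 2)
  let u (i : ι) (z : EuclideanSpace ℝ ι × EuclideanSpace ℝ ι) : ℝ :=
    if σ i then g i z.1 else g i z.2
  have hum (i) : Measurable (u i) := by
    by_cases hi : σ i <;> simp only [u, hi, if_true, if_false] <;> fun_prop
  have hu01 (i z) : u i z ∈ Icc (0 : ℝ) 1 := by
    simp only [u]
    split_ifs <;> exact Real.exp_neg_sq_div_two_mem_Icc _
  have h := integral_prod_sum_pow (μ.prod μ) hum hu01 N (fun i m => (p i).coeff m)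
  simp_rw [← heval] at h
  have hsplit (f : ι → ℝ → ℝ) (z : EuclideanSpace ℝ ι × EuclideanSpace ℝ ι) :
      ∏ i, f i (u i z)
        = (∏ i, if σ i then f i (g i z.1) else 1) * ∏ i, if σ i then 1 else f i (g i z.2) := by
    rw [← Finset.prod_mul_distrib]
    refine Finset.prod_congr rfl fun i _ => ?_
    by_cases hi : σ i <;> simp [u, hi]
  simp_rw [hsplit (fun i => (p i).eval)] at h
  rw [integral_prod_mul (μ := μ) (ν := μ) (fun x => ∏ i, if σ i then (p i).eval (g i x) else 1)
    (fun x => ∏ i, if σ i then 1 else (p i).eval (g i x))] at h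
  rw [h]
  refine Finset.sum_congr rfl fun k _ => ?_
  congr 1
  rw [det_one_add_diagonal_mul_signInterp_zero]
  simp_rw [hsplit (fun i y => y ^ k i)]
  rw [integral_prod_mul (μ := μ) (ν := μ) (fun x => ∏ i, if σ i then g i x ^ k i else 1)
    (fun x => ∏ i, if σ i then 1 else g i x ^ k i)]
  have h1 := integral_prod_exp_pow_multivariateGaussian hC (fun i => if σ i then k i else 0)
  have h2 := integral_prod_exp_pow_multivariateGaussian hC (fun i => if σ i then 0 else k i)
  simp only [pow_ite, pow_zero, Nat.cast_ite, Nat.cast_zero] at h1 h2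
  have hdet := hC.det_one_add_diagonal_mul_pos (k := fun i => if σ i then (k i : ℝ) else 0)
    (fun i => by split_ifs <;> positivity)
  rw [Real.sqrt_mul hdet.le, mul_inv, ← h1, ← h2]

end PolynomialTest

section FiniteFamily

variable {Ω : Type*} [MeasurableSpace Ω]

/-- Every element of the set `V` of functions is a centered Gaussian random variable. -/
def IsCenteredGaussianSet (P : Measure Ω) (V : Set (Ω → ℝ)) : Prop :=
  ∀ f ∈ V, Measurable f ∧ ∃ v : NNReal, P.map f = gaussianReal 0 v

variable {P : Measure Ω} [IsProbabilityMeasure P]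

omit [IsProbabilityMeasure P] in
lemma memLp_two_of_map_eq_gaussianReal {f : Ω → ℝ} (hf : Measurable f) {v : NNReal}
    (h : P.map f = gaussianReal 0 v) : MemLp f 2 P := by
  have := memLp_id_gaussianReal (μ := 0) (v := v) 2
  rw [← h] at this
  exact (memLp_map_measure_iff this.1 hf.aemeasurable).1 this

omit [IsProbabilityMeasure P] in
lemma integral_sq_of_map_eq_gaussianReal {f : Ω → ℝ} (hf : Measurable f) {v : NNReal}
    (h : P.map f = gaussianReal 0 v) : ∫ ω, f ω ^ 2 ∂P = v := by
  have h1 := variance_fun_id_gaussianReal (μ := 0) (v := v)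
  rw [variance_eq_integral (by fun_prop)] at h1
  simp only [integral_id_gaussianReal, sub_zero] at h1
  rw [← h, integral_map hf.aemeasurable (by fun_prop)] at h1
  exact h1

section Law

variable {ι : Type*} [Fintype ι] [DecidableEq ι]

lemma exists_map_toLp_eq_multivariateGaussian {V : Submodule ℝ (Ω → ℝ)}
    (hV : IsCenteredGaussianSet P V) {X : ι → Ω → ℝ} (hX : ∀ i, X i ∈ V) :
    ∃ C : Matrix ι ι ℝ, C.PosSemidef ∧
      P.map (fun ω => WithLp.toLp 2 fun i => X i ω) = multivariateGaussian 0 C := by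
  have hm (i) : Measurable (X i) := (hV _ (hX i)).1
  have hL (i) : MemLp (X i) 2 P := by
    obtain ⟨h, v, hv⟩ := hV _ (hX i)
    exact memLp_two_of_map_eq_gaussianReal h hv
  let C : Matrix ι ι ℝ := Matrix.of fun i j => ∫ ω, X i ω * X j ω ∂P
  have hquad (c : ι → ℝ) : c ⬝ᵥ C *ᵥ c = ∫ ω, (∑ i, c i * X i ω) ^ 2 ∂P := by
    have hint (i j) : Integrable (fun ω => c i * X i ω * (c j * X j ω)) P :=
      ((hL i).const_mul (c i)).integrable_mul ((hL j).const_mul (c j))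
    simp_rw [sq, Finset.sum_mul_sum]
    rw [integral_finsetSum _ fun i _ => integrable_finsetSum _ fun j _ => hint i j]
    simp only [dotProduct, Matrix.mulVec, Finset.mul_sum]
    refine Finset.sum_congr rfl fun i _ => ?_
    rw [integral_finsetSum _ fun j _ => hint i j]
    refine Finset.sum_congr rfl fun j _ => ?_
    simp only [C, Matrix.of_apply]
    rw [← integral_mul_const, ← integral_const_mul]
    congr 1
    ext ω
    ring
  have hC : C.PosSemidef := by
    refine Matrix.PosSemidef.of_dotProduct_mulVec_nonneg ?_ fun c => ?_
    · ext i j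
      simp [C, mul_comm]
    · rw [star_trivial, hquad]
      exact integral_nonneg fun ω => sq_nonneg _
  refine ⟨C, hC, ?_⟩
  have hmeas : Measurable fun ω => WithLp.toLp 2 fun i => X i ω := by fun_prop
  have : IsProbabilityMeasure (P.map fun ω => WithLp.toLp 2 fun i => X i ω) :=
    Measure.isProbabilityMeasure_map hmeas.aemeasurable
  refine Measure.ext_of_charFun (funext fun t => ?_)
  have hmem : (fun ω => ∑ i, t.ofLp i * X i ω) ∈ V := by
    convert V.sum_mem fun i (_ : i ∈ Finset.univ) => V.smul_mem (t.ofLp i) (hX i) using 1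
    ext ω
    simp
  obtain ⟨hfm, v, hv⟩ := hV _ hmem
  have h1 := charFun_gaussianReal (μ := 0) (v := v) 1
  rw [← hv, charFun_apply_real, integral_map hfm.aemeasurable (by fun_prop)] at h1
  rw [charFun_multivariateGaussian hC, hquad, integral_sq_of_map_eq_gaussianReal hfm hv,
    charFun_apply, integral_map hmeas.aemeasurable (by fun_prop)]
  convert h1 using 1
  · congr 1
    ext ω
    simp [PiLp.inner_apply]
  · simp

lemma integral_prod_mul_integral_prod_le {V : Submodule ℝ (Ω → ℝ)}
    (hV : IsCenteredGaussianSet P V) {X : ι → Ω → ℝ} (hX : ∀ i, X i ∈ V)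
    (σ : ι → Prop) [DecidablePred σ] (p : ι → Polynomial ℝ)
    (hp : ∀ i, ∀ u ∈ Icc (0 : ℝ) 1, 0 ≤ (p i).eval u)
    (hp' : ∀ i, ∀ u ∈ Icc (0 : ℝ) 1, 0 ≤ (p i).derivative.eval u) :
    (∫ ω, ∏ i, (if σ i then (p i).eval (Real.exp (-X i ω ^ 2 / 2)) else 1) ∂P) *
      (∫ ω, ∏ i, (if ¬ σ i then (p i).eval (Real.exp (-X i ω ^ 2 / 2)) else 1) ∂P)
      ≤ ∫ ω, ∏ i, (p i).eval (Real.exp (-X i ω ^ 2 / 2)) ∂P := by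
  obtain ⟨C, hC, hlaw⟩ := exists_map_toLp_eq_multivariateGaussian hV hX
  have hm (i) : Measurable (X i) := (hV _ (hX i)).1
  have hmeas : Measurable fun ω => WithLp.toLp 2 fun i => X i ω := by fun_prop
  have h := integral_prod_mul_integral_prod_le_multivariateGaussian hC σ p hp hp'
  have hcont (i) : Continuous fun x : EuclideanSpace ℝ ι =>
      (p i).eval (Real.exp (-x.ofLp i ^ 2 / 2)) :=
    (p i).continuous.comp (by fun_prop)
  rw [← hlaw, integral_map hmeas.aemeasurable, integral_map hmeas.aemeasurable,
    integral_map hmeas.aemeasurable] at h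
  · simpa only [ite_not] using h
  · exact (continuous_finsetProd _ fun i _ => hcont i).aestronglyMeasurable
  · refine (continuous_finsetProd _ fun i _ => ?_).aestronglyMeasurable
    split_ifs
    exacts [continuous_const, hcont i]
  · refine (continuous_finsetProd _ fun i _ => ?_).aestronglyMeasurable
    split_ifs
    exacts [hcont i, continuous_const]

end Law

/-- A polynomial in `u`, nondecreasing on `[0, 1]`, which evaluated at `u = exp (-n x ^ 2 / 2)`
approximates the indicator of `|x| ≤ c` as `n → ∞`. -/
noncomputable def slabPoly (c : ℝ) (n : ℕ) : Polynomial ℝ :=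
  1 - (1 - Polynomial.X) ^ ⌈n * Real.exp (n * c ^ 2 / 2)⌉₊

lemma eval_slabPoly_mem_Icc (c : ℝ) (n : ℕ) {u : ℝ} (hu : u ∈ Icc (0 : ℝ) 1) :
    (slabPoly c n).eval u ∈ Icc (0 : ℝ) 1 := by
  have h0 : 0 ≤ 1 - u := sub_nonneg.2 hu.2
  simp only [slabPoly, Polynomial.eval_sub, Polynomial.eval_one, Polynomial.eval_pow,
    Polynomial.eval_X]
  exact ⟨sub_nonneg.2 (pow_le_one₀ h0 (by linarith [hu.1])), sub_le_self _ (pow_nonneg h0 _)⟩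

lemma eval_derivative_slabPoly_nonneg (c : ℝ) (n : ℕ) {u : ℝ} (hu : u ∈ Icc (0 : ℝ) 1) :
    0 ≤ (slabPoly c n).derivative.eval u := by
  have h0 : 0 ≤ 1 - u := sub_nonneg.2 hu.2
  simp [slabPoly, Polynomial.derivative_pow]
  positivity

lemma tendsto_eval_slabPoly {c : ℝ} (hc : 0 ≤ c) (x : ℝ) :
    Filter.Tendsto (fun n : ℕ => (slabPoly c n).eval (Real.exp (-(√n * x) ^ 2 / 2)))
      Filter.atTop (nhds (if |x| ≤ c then 1 else 0)) := by
  have hx (n : ℕ) : -(√n * x) ^ 2 / 2 = n * (-x ^ 2 / 2) := by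
    rw [mul_pow, Real.sq_sqrt n.cast_nonneg]; ring
  have hmem (n : ℕ) := Real.exp_neg_sq_div_two_mem_Icc (√n * x)
  have hprod (n : ℕ) : n * Real.exp (n * c ^ 2 / 2) * Real.exp (-(√n * x) ^ 2 / 2)
      = n * Real.exp ((c ^ 2 - x ^ 2) / 2) ^ n := by
    rw [mul_assoc, ← Real.exp_add, ← Real.exp_nat_mul, hx]
    congr 2; ring
  split_ifs with h
  · have hle (n : ℕ) : 1 - Real.exp (-1) ^ n
        ≤ (slabPoly c n).eval (Real.exp (-(√n * x) ^ 2 / 2)) := by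
      simp only [slabPoly, Polynomial.eval_sub, Polynomial.eval_one, Polynomial.eval_pow,
        Polynomial.eval_X]
      set u := Real.exp (-(√n * x) ^ 2 / 2)
      set M := ⌈n * Real.exp (n * c ^ 2 / 2)⌉₊
      have h1 : (1 - u) ^ M ≤ Real.exp (-u) ^ M :=
        pow_le_pow_left₀ (sub_nonneg.2 (hmem n).2) (by linarith [Real.add_one_le_exp (-u)]) _
      have h2 : (n : ℝ) ≤ M * u := by
        calc (n : ℝ) ≤ n * Real.exp ((c ^ 2 - x ^ 2) / 2) ^ n := by
              refine le_mul_of_one_le_right n.cast_nonneg (one_le_pow₀ (Real.one_le_exp ?_))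
              have := sq_le_sq' (abs_le.1 h).1 (abs_le.1 h).2
              linarith
          _ = n * Real.exp (n * c ^ 2 / 2) * u := (hprod n).symm
          _ ≤ M * u := mul_le_mul_of_nonneg_right (Nat.le_ceil _) (hmem n).1
      have h3 : Real.exp (-u) ^ M ≤ Real.exp (-1) ^ n := by
        rw [← Real.exp_nat_mul, ← Real.exp_nat_mul]
        exact Real.exp_le_exp.2 (by linarith)
      linarith
    have hlim : Filter.Tendsto (fun n : ℕ => 1 - Real.exp (-1) ^ n) Filter.atTop (nhds 1) := by
      simpa using (tendsto_pow_atTop_nhds_zero_of_lt_one (Real.exp_pos (-1)).le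
        (Real.exp_lt_one_iff.2 (by norm_num))).const_sub 1
    exact tendsto_of_tendsto_of_tendsto_of_le_of_le hlim tendsto_const_nhds hle
      fun n => (eval_slabPoly_mem_Icc c n (hmem n)).2
  · have hxc : c ^ 2 < x ^ 2 := by
      rw [← sq_abs x]
      exact pow_lt_pow_left₀ (not_le.1 h) hc two_ne_zero
    have hle (n : ℕ) : (slabPoly c n).eval (Real.exp (-(√n * x) ^ 2 / 2))
        ≤ n * Real.exp ((c ^ 2 - x ^ 2) / 2) ^ n + Real.exp (-x ^ 2 / 2) ^ n := by
      simp only [slabPoly, Polynomial.eval_sub, Polynomial.eval_one, Polynomial.eval_pow,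
        Polynomial.eval_X]
      rw [← hprod, ← Real.exp_nat_mul, ← hx]
      set u := Real.exp (-(√n * x) ^ 2 / 2)
      set M := ⌈n * Real.exp (n * c ^ 2 / 2)⌉₊
      have h1 := one_add_mul_le_pow (a := -u) (by linarith [(hmem n).2]) M
      have h2 : (M : ℝ) ≤ n * Real.exp (n * c ^ 2 / 2) + 1 := (Nat.ceil_lt_add_one (by positivity)).le
      rw [← sub_eq_add_neg] at h1
      nlinarith [mul_le_mul_of_nonneg_right h2 (hmem n).1]
    have hlim : Filter.Tendsto (fun n : ℕ => n * Real.exp ((c ^ 2 - x ^ 2) / 2) ^ n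
        + Real.exp (-x ^ 2 / 2) ^ n) Filter.atTop (nhds 0) := by
      simpa using (tendsto_self_mul_const_pow_of_lt_one (Real.exp_pos _).le
        (Real.exp_lt_one_iff.2 (by linarith : (c ^ 2 - x ^ 2) / 2 < 0))).add
        (tendsto_pow_atTop_nhds_zero_of_lt_one (Real.exp_pos _).le
        (Real.exp_lt_one_iff.2 (by nlinarith [sq_nonneg c] : -x ^ 2 / 2 < 0)))
    exact tendsto_of_tendsto_of_tendsto_of_le_of_le tendsto_const_nhds hlim
      (fun n => (eval_slabPoly_mem_Icc c n (hmem n)).1) hle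

lemma tendsto_integral_prod_slabPoly {ι : Type*} [Fintype ι] {X : ι → Ω → ℝ}
    (hX : ∀ i, Measurable (X i)) {c : ι → ℝ} (hc : ∀ i, 0 ≤ c i) (τ : ι → Prop)
    [DecidablePred τ] :
    Filter.Tendsto (fun n : ℕ => ∫ ω, ∏ i, (if τ i then
      (slabPoly (c i) n).eval (Real.exp (-(√n * X i ω) ^ 2 / 2)) else 1) ∂P)
      Filter.atTop (nhds (P.real {ω | ∀ i, τ i → |X i ω| ≤ c i})) := by
  have hms : MeasurableSet {ω | ∀ i, τ i → |X i ω| ≤ c i} := by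
    simp only [ofPred_forall]
    exact MeasurableSet.iInter fun i => MeasurableSet.iInter fun _ =>
      measurableSet_le (by fun_prop) measurable_const
  have hmem (i : ι) (n : ℕ) (ω : Ω) :
      (if τ i then (slabPoly (c i) n).eval (Real.exp (-(√n * X i ω) ^ 2 / 2)) else 1)
        ∈ Icc (0 : ℝ) 1 := by
    split_ifs
    · exact eval_slabPoly_mem_Icc _ _ (Real.exp_neg_sq_div_two_mem_Icc _)
    · exact ⟨zero_le_one, le_rfl⟩
  rw [← integral_indicator_one hms]
  refine tendsto_integral_of_dominated_convergence (fun _ => 1) (fun n => ?_)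
    (integrable_const _) (fun n => Filter.Eventually.of_forall fun ω => ?_)
    (Filter.Eventually.of_forall fun ω => ?_)
  · refine (Finset.measurable_prod _ fun i _ => ?_).aestronglyMeasurable
    split_ifs
    · exact (slabPoly (c i) n).continuous.measurable.comp (by fun_prop)
    · exact measurable_const
  · rw [Real.norm_eq_abs, abs_of_nonneg (Finset.prod_nonneg fun i _ => (hmem i n ω).1)]
    exact Finset.prod_le_one (fun i _ => (hmem i n ω).1) fun i _ => (hmem i n ω).2
  · have heq : ({ω | ∀ i, τ i → |X i ω| ≤ c i} : Set Ω).indicator (1 : Ω → ℝ) ω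
        = ∏ i, (if τ i then (if |X i ω| ≤ c i then 1 else 0) else 1) := by
      by_cases h : ∀ i, τ i → |X i ω| ≤ c i
      · rw [indicator_of_mem (by exact h)]
        refine (Finset.prod_eq_one fun i _ => ?_).symm
        by_cases hi : τ i <;> simp [hi, h]
      · rw [indicator_of_notMem (by exact h)]
        push Not at h
        obtain ⟨i, hi, hlt⟩ := h
        refine (Finset.prod_eq_zero (Finset.mem_univ i) ?_).symm
        simp [hi, hlt]
    rw [heq]
    refine tendsto_finsetProd _ fun i _ => ?_
    split_ifs with hi h
    · simpa [h] using tendsto_eval_slabPoly (hc i) (X i ω)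
    · simpa [h] using tendsto_eval_slabPoly (hc i) (X i ω)
    · exact tendsto_const_nhds

/-- The Gaussian correlation inequality for finitely many symmetric slabs. -/
theorem measureReal_mul_le_measureReal_slab {ι : Type*} [Fintype ι] {V : Submodule ℝ (Ω → ℝ)}
    (hV : IsCenteredGaussianSet P V) {X : ι → Ω → ℝ} (hX : ∀ i, X i ∈ V) {c : ι → ℝ}
    (hc : ∀ i, 0 ≤ c i) (σ : ι → Prop) :
    P.real {ω | ∀ i, σ i → |X i ω| ≤ c i} * P.real {ω | ∀ i, ¬ σ i → |X i ω| ≤ c i}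
      ≤ P.real {ω | ∀ i, |X i ω| ≤ c i} := by
  classical
  have hm (i) : Measurable (X i) := (hV _ (hX i)).1
  have h := tendsto_integral_prod_slabPoly (P := P) hm hc fun _ => True
  simp only [if_true, true_imp_iff] at h
  refine le_of_tendsto_of_tendsto' ((tendsto_integral_prod_slabPoly hm hc σ).mul
    (tendsto_integral_prod_slabPoly hm hc fun i => ¬ σ i)) h fun n => ?_
  exact integral_prod_mul_integral_prod_le hV (X := fun i ω => √n * X i ω)
    (fun i => V.smul_mem (√n) (hX i)) σ (fun i => slabPoly (c i) n)
    (fun i u hu => (eval_slabPoly_mem_Icc _ _ hu).1)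
    fun i u hu => eval_derivative_slabPoly_nonneg _ _ hu

lemma measureReal_mul_le_measureReal_union {κ : Type*} [DecidableEq κ] {V : Submodule ℝ (Ω → ℝ)}
    (hV : IsCenteredGaussianSet P V) {Z : κ → Ω → ℝ} (hZ : ∀ x, Z x ∈ V) {c : κ → ℝ}
    (hc : ∀ x, 0 ≤ c x) (A B : Finset κ) :
    P.real {ω | ∀ x ∈ A, |Z x ω| ≤ c x} * P.real {ω | ∀ x ∈ B, |Z x ω| ≤ c x}
      ≤ P.real {ω | ∀ x ∈ A ∪ B, |Z x ω| ≤ c x} := by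
  let e : A ⊕ B → κ := Sum.elim (fun x => x.1) fun x => x.1
  have h := measureReal_mul_le_measureReal_slab hV (X := fun i : A ⊕ B => Z (e i))
    (fun i => hZ _) (c := fun i => c (e i)) (fun i => hc _) (fun i => i.isLeft)
  simp only [Sum.forall, Sum.isLeft_inl, Sum.isLeft_inr, Subtype.forall, e, Sum.elim_inl,
    Sum.elim_inr, forall_true_left, not_true, Bool.false_eq_true, not_false_iff,
    false_imp_iff, implies_true, and_true, true_and] at h
  simpa only [Finset.mem_union, or_imp, forall_and] using h

lemma prod_measureReal_le_measureReal_biUnion {κ J : Type*} [DecidableEq κ]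
    {V : Submodule ℝ (Ω → ℝ)}
    (hV : IsCenteredGaussianSet P V) {Z : κ → Ω → ℝ} (hZ : ∀ x, Z x ∈ V) {c : κ → ℝ}
    (hc : ∀ x, 0 ≤ c x) (S : Finset J) (A : J → Finset κ) :
    ∏ j ∈ S, P.real {ω | ∀ x ∈ A j, |Z x ω| ≤ c x}
      ≤ P.real {ω | ∀ x ∈ S.biUnion A, |Z x ω| ≤ c x} := by
  classical
  induction S using Finset.induction_on with
  | empty => simp
  | insert j S hj ih =>
    rw [Finset.prod_insert hj, Finset.biUnion_insert]
    exact (mul_le_mul_of_nonneg_left ih measureReal_nonneg).trans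
      (measureReal_mul_le_measureReal_union hV hZ hc _ _)

/-- The Gaussian correlation inequality for countably many symmetric slabs, grouped into finitely
many symmetric convex sets. -/
theorem prod_measureReal_le_measureReal_countable {J : Type*} [Fintype J]
    {V : Submodule ℝ (Ω → ℝ)} (hV : IsCenteredGaussianSet P V) {Z : J → ℕ → Ω → ℝ}
    (hZ : ∀ j n, Z j n ∈ V) {c : J → ℝ} (hc : ∀ j, 0 ≤ c j) :
    ∏ j, P.real {ω | ∀ n, |Z j n ω| ≤ c j} ≤ P.real {ω | ∀ j n, |Z j n ω| ≤ c j} := by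
  classical
  have hm (j n) : Measurable (Z j n) := (hV _ (hZ j n)).1
  let E (j : J) (N : ℕ) : Set Ω := {ω | ∀ n < N, |Z j n ω| ≤ c j}
  have hEm (j N) : MeasurableSet (E j N) := by
    simp only [E, ofPred_forall]
    exact MeasurableSet.iInter fun n => MeasurableSet.iInter fun _ =>
      measurableSet_le (hm j n).abs measurable_const
  have hanti (j) : Antitone (E j) := fun N M hNM ω hω n hn => hω n (hn.trans_le hNM)
  have h1 (j : J) : Filter.Tendsto (fun N => P.real (E j N)) Filter.atTop
      (nhds (P.real {ω | ∀ n, |Z j n ω| ≤ c j})) := by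
    have hset : {ω | ∀ n, |Z j n ω| ≤ c j} = ⋂ N, E j N := by
      ext ω
      simp only [E, mem_ofPred_eq, mem_iInter]
      exact ⟨fun h _ n _ => h n, fun h n => h (n + 1) n n.lt_succ_self⟩
    rw [hset]
    exact (ENNReal.tendsto_toReal (measure_ne_top _ _)).comp
      (tendsto_measure_iInter_atTop (fun N => (hEm j N).nullMeasurableSet) (hanti j)
        ⟨0, measure_ne_top _ _⟩)
  have h2 : Filter.Tendsto (fun N => P.real (⋂ j, E j N)) Filter.atTop
      (nhds (P.real {ω | ∀ j n, |Z j n ω| ≤ c j})) := by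
    have hset : {ω | ∀ j n, |Z j n ω| ≤ c j} = ⋂ N, ⋂ j, E j N := by
      ext ω
      simp only [E, mem_ofPred_eq, mem_iInter]
      exact ⟨fun h _ j n _ => h j n, fun h j n => h (n + 1) j n n.lt_succ_self⟩
    rw [hset]
    exact (ENNReal.tendsto_toReal (measure_ne_top _ _)).comp
      (tendsto_measure_iInter_atTop
        (fun N => (MeasurableSet.iInter fun j => hEm j N).nullMeasurableSet)
        (fun N M hNM => iInter_mono fun j => hanti j hNM) ⟨0, measure_ne_top _ _⟩)
  refine le_of_tendsto_of_tendsto' (tendsto_finsetProd _ fun j _ => h1 j) h2 fun N => ?_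
  have h := prod_measureReal_le_measureReal_biUnion hV (Z := fun x : J × ℕ => Z x.1 x.2)
    (fun x => hZ _ _) (c := fun x => c x.1) (fun x => hc _) Finset.univ
    (fun j => (Finset.range N).image fun n => (j, n))
  have h3 : ⋂ j, E j N = {ω | ∀ x ∈ Finset.univ.biUnion fun j : J =>
      (Finset.range N).image fun n => (j, n), |Z x.1 x.2 ω| ≤ c x.1} := by
    ext ω
    simp only [E, mem_iInter, mem_ofPred_eq, Finset.mem_biUnion, Finset.mem_univ, true_and,
      Finset.mem_image, Finset.mem_range]
    exact ⟨fun h x ⟨j, n, hn, hx⟩ => hx ▸ h j n hn, fun h j n hn => h (j, n) ⟨j, n, hn, rfl⟩⟩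
  simpa [h3, E] using h

end FiniteFamily

end GaussianCorrelation

/-- The space of pointwise sequential limits of elements of `V`. -/
def Submodule.seqLimits {Ω : Type*} (V : Submodule ℝ (Ω → ℝ)) : Submodule ℝ (Ω → ℝ) where
  carrier := {f | ∃ Y : ℕ → Ω → ℝ, (∀ n, Y n ∈ V) ∧
    ∀ ω, Filter.Tendsto (fun n => Y n ω) Filter.atTop (nhds (f ω))}
  add_mem' := by
    rintro f g ⟨Y, hY, hf⟩ ⟨Z, hZ, hg⟩
    exact ⟨Y + Z, fun n => V.add_mem (hY n) (hZ n), fun ω => (hf ω).add (hg ω)⟩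
  zero_mem' := ⟨0, fun _ => V.zero_mem, fun _ => tendsto_const_nhds⟩
  smul_mem' := by
    rintro c f ⟨Y, hY, hf⟩
    exact ⟨c • Y, fun n => V.smul_mem c (hY n), fun ω => (hf ω).const_mul c⟩

lemma Submodule.le_seqLimits {Ω : Type*} (V : Submodule ℝ (Ω → ℝ)) : V ≤ V.seqLimits :=
  fun f hf => ⟨fun _ => f, fun _ => hf, fun _ => tendsto_const_nhds⟩

section GaussianLimit

variable {Ω : Type*} [MeasurableSpace Ω] {P : Measure Ω}

lemma isCenteredGaussianSet_span {T : Type*} {S : Set T} {X : T → Ω → ℝ}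
    (hmeas : ∀ t, Measurable (X t))
    (hgauss : ∀ (n : ℕ) (t : Fin n → T), (∀ k, t k ∈ S) →
      ∀ c : Fin n → ℝ, ∃ v : NNReal,
        Measure.map (fun ω => ∑ i, c i * X (t i) ω) P = gaussianReal 0 v) :
    IsCenteredGaussianSet P (Submodule.span ℝ (X '' S) : Submodule ℝ (Ω → ℝ)) := by
  intro f hf
  obtain ⟨n, c, g, rfl⟩ := Submodule.mem_span_set'.1 hf
  choose t ht htg using fun i => (g i).2
  have heq : ∑ i, c i • (g i : Ω → ℝ) = fun ω => ∑ i, c i * X (t i) ω := by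
    ext ω
    simp [htg]
  rw [heq]
  exact ⟨Finset.measurable_sum _ fun i _ => (hmeas _).const_mul _, hgauss n t ht c⟩

variable [IsProbabilityMeasure P]

lemma tendsto_charFun_map {Y : ℕ → Ω → ℝ} {W : Ω → ℝ} (hY : ∀ n, Measurable (Y n))
    (hW : Measurable W)
    (h : ∀ ω, Filter.Tendsto (fun n => Y n ω) Filter.atTop (nhds (W ω))) (s : ℝ) :
    Filter.Tendsto (fun n => charFun (P.map (Y n)) s) Filter.atTop
      (nhds (charFun (P.map W) s)) := by
  have heq {f : Ω → ℝ} (hf : Measurable f) :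
      charFun (P.map f) s = ∫ ω, Complex.exp (s * f ω * Complex.I) ∂P := by
    rw [charFun_apply_real, integral_map hf.aemeasurable (by fun_prop)]
  simp_rw [heq hW, fun n => heq (hY n)]
  refine tendsto_integral_of_dominated_convergence (fun _ => 1) (fun n => ?_)
    (integrable_const _) (fun n => Filter.Eventually.of_forall fun ω => ?_)
    (Filter.Eventually.of_forall fun ω => ?_)
  · have := hY n
    exact Measurable.aestronglyMeasurable (by fun_prop)
  · rw [← Complex.ofReal_mul, Complex.norm_exp_ofReal_mul_I]
  · have hc : Continuous fun x : ℝ => Complex.exp (s * x * Complex.I) := by fun_prop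
    exact (hc.tendsto _).comp (h ω)

lemma exists_map_eq_gaussianReal_of_tendsto {Y : ℕ → Ω → ℝ} {W : Ω → ℝ}
    (hY : ∀ n, Measurable (Y n)) (hg : ∀ n, ∃ v : NNReal, P.map (Y n) = gaussianReal 0 v)
    (h : ∀ ω, Filter.Tendsto (fun n => Y n ω) Filter.atTop (nhds (W ω))) :
    Measurable W ∧ ∃ v : NNReal, P.map W = gaussianReal 0 v := by
  have hW : Measurable W := measurable_of_tendsto_metrizable hY (tendsto_pi_nhds.2 h)
  have : IsProbabilityMeasure (P.map W) := Measure.isProbabilityMeasure_map hW.aemeasurable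
  refine ⟨hW, ?_⟩
  choose v hv using hg
  have hlim (s : ℝ) : Filter.Tendsto (fun n => Complex.exp (-(v n * s ^ 2 / 2)))
      Filter.atTop (nhds (charFun (P.map W) s)) := by
    have := tendsto_charFun_map (P := P) hY hW h s
    simp_rw [hv, charFun_gaussianReal] at this
    simpa using this
  obtain ⟨s, hs, hs0⟩ : ∃ s : ℝ, charFun (P.map W) s ≠ 0 ∧ s ≠ 0 := by
    have hc : ContinuousAt (charFun (P.map W)) 0 := continuous_charFun.continuousAt
    have h1 : ∀ᶠ s in nhds (0 : ℝ), charFun (P.map W) s ≠ 0 :=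
      hc.eventually_ne (by simp)
    exact ((h1.filter_mono nhdsWithin_le_nhds).and self_mem_nhdsWithin).exists
      (f := nhdsWithin 0 {0}ᶜ)
  have hv' : Filter.Tendsto (fun n => (v n : ℝ)) Filter.atTop
      (nhds (-2 / s ^ 2 * Real.log ‖charFun (P.map W) s‖)) := by
    convert ((hlim s).norm.log (norm_ne_zero_iff.2 hs)).const_mul (-2 / s ^ 2) using 2 with n
    have : (-(v n * s ^ 2 / 2) : ℂ).re = -(v n * s ^ 2 / 2) := by
      norm_cast
    rw [Complex.norm_exp, this, Real.log_exp]
    field_simp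
  obtain ⟨w, hw⟩ : ∃ w : NNReal, (w : ℝ) = -2 / s ^ 2 * Real.log ‖charFun (P.map W) s‖ :=
    ⟨⟨_, ge_of_tendsto' hv' fun n => (v n).2⟩, rfl⟩
  rw [← hw] at hv'
  refine ⟨w, Measure.ext_of_charFun (funext fun t => ?_)⟩
  refine tendsto_nhds_unique (hlim t) ?_
  rw [charFun_gaussianReal]
  have hc : Continuous fun x : ℝ => Complex.exp (-(x * t ^ 2 / 2)) := by fun_prop
  have := (hc.tendsto _).comp hv'
  simpa [Function.comp_def] using this

lemma IsCenteredGaussianSet.seqLimits {V : Submodule ℝ (Ω → ℝ)}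
    (hV : IsCenteredGaussianSet P V) : IsCenteredGaussianSet P V.seqLimits := by
  rintro f ⟨Y, hY, hf⟩
  exact exists_map_eq_gaussianReal_of_tendsto (fun n => (hV _ (hY n)).1)
    (fun n => (hV _ (hY n)).2) hf

end GaussianLimit

section Cube

variable {n : ℕ}

lemma uniqueDiffOn_cube : UniqueDiffOn ℝ (cube n) :=
  UniqueDiffOn.univ_pi fun _ => uniqueDiffOn_Icc (by norm_num)

/-- From every point of the cube one can move inside the cube along each coordinate axis. -/
lemma exists_forall_add_single_mem_cube {t : Fin n → ℝ} (ht : t ∈ cube n) (i : Fin n) :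
    ∃ s : ℝ, s ≠ 0 ∧ ∀ r ∈ Icc (0 : ℝ) 1, t + Pi.single i (r * s) ∈ cube n := by
  have h (s : ℝ) (hs : ∀ r ∈ Icc (0 : ℝ) 1, t i + r * s ∈ Icc (-1 : ℝ) 1) (r : ℝ)
      (hr : r ∈ Icc (0 : ℝ) 1) : t + Pi.single i (r * s) ∈ cube n := by
    intro j _
    obtain rfl | hj := eq_or_ne j i
    · simpa using hs r hr
    · simpa [hj] using ht j trivial
  have hti := ht i trivial
  rcases le_total (t i) 0 with h0 | h0
  · exact ⟨1, one_ne_zero, h 1 fun r hr => ⟨by linarith [hr.1, hti.1], by linarith [hr.2]⟩⟩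
  · exact ⟨-1, by norm_num, h (-1) fun r hr => ⟨by linarith [hr.2], by linarith [hr.1, hti.2]⟩⟩

lemma exists_seq_forall_abs_le_iff_cube (n : ℕ) : ∃ q : ℕ → Fin n → ℝ, (∀ k, q k ∈ cube n) ∧
    ∀ f : (Fin n → ℝ) → ℝ, ContinuousOn f (cube n) → ∀ c : ℝ,
      (∀ t ∈ cube n, |f t| ≤ c) ↔ ∀ k, |f (q k)| ≤ c := by
  have : Nonempty (cube n) := ⟨⟨0, fun _ _ => by simp⟩⟩
  refine ⟨fun k => TopologicalSpace.denseSeq (cube n) k, fun k => Subtype.coe_prop _,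
    fun f hf c => ⟨fun h k => h _ (Subtype.coe_prop _), fun h t ht => ?_⟩⟩
  have hclosed : IsClosed {x : cube n | |f x| ≤ c} :=
    isClosed_le (continuousOn_iff_continuous_domRestrict.1 hf).abs continuous_const
  have hsub : closure (range (TopologicalSpace.denseSeq (cube n))) ⊆ {x : cube n | |f x| ≤ c} :=
    closure_minimal (range_subset_iff.2 h) hclosed
  rw [(TopologicalSpace.denseRange_denseSeq (cube n)).closure_eq] at hsub
  exact hsub (mem_univ (⟨t, ht⟩ : cube n))

lemma fderivWithin_single_mem_seqLimits {Ω : Type*}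
    {V : Submodule ℝ (Ω → ℝ)} {X : (Fin n → ℝ) → Ω → ℝ}
    (hX : ∀ t ∈ cube n, X t ∈ V)
    (hdiff : ∀ ω, DifferentiableOn ℝ (fun t => X t ω) (cube n)) {t : Fin n → ℝ}
    (ht : t ∈ cube n) (i : Fin n) :
    (fun ω => fderivWithin ℝ (fun u => X u ω) (cube n) t (Pi.single i 1)) ∈ V.seqLimits := by
  obtain ⟨s, hs, hmem⟩ := exists_forall_add_single_mem_cube ht i
  let r (k : ℕ) : ℝ := 1 / (k + 1)
  have hr (k : ℕ) : r k ∈ Icc (0 : ℝ) 1 := ⟨by positivity, by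
    simp only [r]; rw [div_le_one (by positivity)]; linarith [k.cast_nonneg (α := ℝ)]⟩
  refine ⟨fun k => (r k * s)⁻¹ • (X (t + Pi.single i (r k * s)) - X t),
    fun k => V.smul_mem _ (V.sub_mem (hX _ (hmem _ (hr k))) (hX _ ht)), fun ω => ?_⟩
  have hne (k : ℕ) : r k * s ≠ 0 := mul_ne_zero (by positivity) hs
  have hlim : Filter.Tendsto (fun k => r k * s) Filter.atTop (nhds 0) := by
    simpa [r] using (tendsto_one_div_add_atTop_nhds_zero_nat (𝕜 := ℝ)).mul_const s
  have hsingle (x : ℝ) : Pi.single (M := fun _ : Fin n => ℝ) i x = x • Pi.single i 1 := by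
    rw [← Pi.single_smul]; simp
  refine (hdiff ω t ht).hasFDerivWithinAt.lim (c := fun k => (r k * s)⁻¹)
    (d := fun k => Pi.single i (r k * s)) ?_ (Filter.Eventually.of_forall fun k => hmem _ (hr k)) ?_
  · have := hlim.smul_const (Pi.single (M := fun _ : Fin n => ℝ) i 1)
    rw [zero_smul] at this
    exact this.congr fun k => (hsingle _).symm
  · refine tendsto_const_nhds.congr fun k => ?_
    rw [hsingle (r k * s), smul_smul, inv_mul_cancel₀ (hne k), one_smul]

end Cube

/-- for a centered Gaussian process on `[-1,1]^ℓ` with continuously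
differentiable sample paths, the probability that both the process is uniformly bounded by `a`
and each partial derivative process is uniformly bounded by `b i` is at least the product of
the corresponding individual probabilities. The centered Gaussian hypothesis is expressed
through the standard characterization: every finite linear combination of values of the
process has a (possibly degenerate) centered real Gaussian distribution. -/
theorem stmt10 (ℓ : ℕ) (hℓ : 0 < ℓ)
    {Ω : Type*} [MeasurableSpace Ω] (P : Measure Ω) [IsProbabilityMeasure P]
    (X : (Fin ℓ → ℝ) → Ω → ℝ)
    (hmeas : ∀ t, Measurable (X t))
    (hpath : ∀ ω, ContDiffOn ℝ 1 (fun t => X t ω) (cube ℓ))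
    (hgauss : ∀ (n : ℕ) (t : Fin n → (Fin ℓ → ℝ)), (∀ k, t k ∈ cube ℓ) →
      ∀ c : Fin n → ℝ, ∃ v : NNReal,
        Measure.map (fun ω => ∑ i, c i * X (t i) ω) P = gaussianReal 0 v)
    (D : Fin ℓ → (Fin ℓ → ℝ) → Ω → ℝ)
    (hD : ∀ i t ω, D i t ω = fderivWithin ℝ (fun s => X s ω) (cube ℓ) t (Pi.single i 1))
    (a : ℝ) (ha : 0 < a) (b : Fin ℓ → ℝ) (hb : ∀ i, 0 < b i) :
    P {ω | (∀ t ∈ cube ℓ, |X t ω| ≤ a) ∧ ∀ i, ∀ t ∈ cube ℓ, |D i t ω| ≤ b i} ≥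
      P {ω | ∀ t ∈ cube ℓ, |X t ω| ≤ a} * ∏ i, P {ω | ∀ t ∈ cube ℓ, |D i t ω| ≤ b i} := by
  obtain ⟨q, hq, hqf⟩ := exists_seq_forall_abs_le_iff_cube ℓ
  let V := (Submodule.span ℝ (X '' cube ℓ)).seqLimits
  have hV : IsCenteredGaussianSet P V := (isCenteredGaussianSet_span hmeas hgauss).seqLimits
  have hXS (t) (ht : t ∈ cube ℓ) : X t ∈ Submodule.span ℝ (X '' cube ℓ) :=
    Submodule.subset_span (mem_image_of_mem X ht)
  have hDV (i t) (ht : t ∈ cube ℓ) : D i t ∈ V := by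
    rw [funext fun ω => hD i t ω]
    exact fderivWithin_single_mem_seqLimits hXS
      (fun ω => (hpath ω).differentiableOn one_ne_zero) ht i
  have hDc (i ω) : ContinuousOn (fun t => D i t ω) (cube ℓ) := by
    simp_rw [hD]
    exact ((hpath ω).continuousOn_fderivWithin uniqueDiffOn_cube le_rfl).clm_apply
      continuousOn_const
  have hX' (ω) := hqf _ (hpath ω).continuousOn a
  have hD' (ω i) := hqf _ (hDc i ω) (b i)
  have h := prod_measureReal_le_measureReal_countable hV (J := Option (Fin ℓ))
    (Z := fun j n => j.elim (X (q n)) fun i => D i (q n)) (c := fun j => j.elim a b)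
    (Option.forall.2 ⟨fun n => Submodule.le_seqLimits _ (hXS _ (hq n)),
      fun i n => hDV i _ (hq n)⟩)
    (Option.forall.2 ⟨ha.le, fun i => (hb i).le⟩)
  simp only [Fintype.prod_option, Option.forall, Option.elim] at h
  simp only [hX', hD', ge_iff_le]
  rw [← ENNReal.toReal_le_toReal (ENNReal.mul_ne_top (measure_ne_top _ _)
    (ENNReal.prod_ne_top fun i _ => measure_ne_top _ _)) (measure_ne_top _ _),
    ENNReal.toReal_mul, ENNReal.toReal_prod]
  exact h
end
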